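/- Telescoping bound: let Φ, Ψ be channels from A to B with dim H_B = d_B < ∞, n ∈ ℕ, and let ρ be any state on H_A^⊗n ⊗ H_CD such that (1/2)·sup{‖(Φ−Ψ)⊗id_R(ω)‖₁ : ω a state with ω_A ∈ {ρ_{A₁},…,ρ_{A_n}}} ≤ ε. Then |I(Bⁿ:D|C)_{Φ^⊗n⊗id(ρ)} − I(Bⁿ:D|C)_{Ψ^⊗n⊗id(ρ)}| ≤ 2nε·log d_B + n·g(ε). -/

import Mathlib

set_option maxHeartbeats 1000000

open Matrix Real
open scoped ComplexOrder

noncomputable section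

/-- The von Neumann entropy of a (Hermitian) matrix, via its eigenvalues. -/
def vnEntropy {n : Type*} [Fintype n] [DecidableEq n] (A : Matrix n n ℂ) : ℝ :=
  if h : A.IsHermitian then ∑ i, Real.negMulLog (h.eigenvalues i) else 0

/-- The trace norm of a matrix: the sum of its singular values. -/
def traceNorm {n : Type*} [Fintype n] [DecidableEq n] (A : Matrix n n ℂ) : ℝ :=
  ∑ i, Real.sqrt ((Matrix.posSemidef_conjTranspose_mul_self A).1.eigenvalues i)

/-- g(ε) = (1+ε)·log(1+ε) − ε·log ε. -/
def gFun (x : ℝ) : ℝ := (1 + x) * Real.log (1 + x) - x * Real.log x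

section Channels

variable {a b : Type*} [Fintype a] [DecidableEq a] [Fintype b] [DecidableEq b]

/-- A linear map on matrices, represented by its transfer tensor `T`, applied to `ρ`:
`Φ(ρ) i j = Σ_{k,l} T i j k l · ρ k l`. -/
def chApply (T : b → b → a → a → ℂ) (ρ : Matrix a a ℂ) : Matrix b b ℂ :=
  fun i j => ∑ k, ∑ l, T i j k l * ρ k l

/-- The map `Φ ⊗ id_R` applied to an operator on the composite system `A ⊗ R`. -/
def chApplyExt (T : b → b → a → a → ℂ) {r : Type*} [Fintype r]
    (ρ : Matrix (a × r) (a × r) ℂ) : Matrix (b × r) (b × r) ℂ :=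
  fun x y => ∑ k, ∑ l, T x.1 y.1 k l * ρ (k, x.2) (l, y.2)

/-- `T` represents a quantum channel: completely positive (every extension `Φ ⊗ id_R`
preserves positive semidefiniteness) and trace preserving. -/
def IsChannel (T : b → b → a → a → ℂ) : Prop :=
  (∀ ρ : Matrix a a ℂ, (chApply T ρ).trace = ρ.trace) ∧
  (∀ (r : Type) [Fintype r] [DecidableEq r], ∀ ρ : Matrix (a × r) (a × r) ℂ,
      ρ.PosSemidef → (chApplyExt T ρ).PosSemidef)

/-- The map `Φ^{⊗n} ⊗ id_R` applied to an operator on `A^{⊗n} ⊗ R`. -/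
def chApplyPow (T : b → b → a → a → ℂ) {n : ℕ} {r : Type*} [Fintype r]
    (ρ : Matrix ((Fin n → a) × r) ((Fin n → a) × r) ℂ) :
    Matrix ((Fin n → b) × r) ((Fin n → b) × r) ℂ :=
  fun X Y => ∑ K : Fin n → a, ∑ L : Fin n → a,
    (∏ m, T (X.1 m) (Y.1 m) (K m) (L m)) * ρ (K, X.2) (L, Y.2)

/-- The marginal of the k-th input subsystem `A_k` of a state on `A^{⊗n} ⊗ R`. -/
def margAk {n : ℕ} {r : Type*} [Fintype r]
    (ρ : Matrix ((Fin n → a) × r) ((Fin n → a) × r) ℂ) (k : Fin n) : Matrix a a ℂ :=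
  fun i j => ∑ f : Fin n → a, ∑ w : r,
    if f k = i then ρ (f, w) (Function.update f k j, w) else 0

/-- Partial trace over a reference system. -/
def ptraceRef {r : Type*} [Fintype r] (ω : Matrix (a × r) (a × r) ℂ) : Matrix a a ℂ :=
  fun i j => ∑ w, ω (i, w) (j, w)

end Channels

section QCMI

variable {x γ δ : Type*} [Fintype x] [DecidableEq x] [Fintype γ] [DecidableEq γ]
  [Fintype δ] [DecidableEq δ]

/-- The marginal ρ_XC of a state on X ⊗ C ⊗ D. -/
def mXC (ρ : Matrix (x × γ × δ) (x × γ × δ) ℂ) : Matrix (x × γ) (x × γ) ℂ :=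
  fun u v => ∑ w : δ, ρ (u.1, u.2, w) (v.1, v.2, w)

/-- The marginal ρ_CD of a state on X ⊗ C ⊗ D. -/
def mCD (ρ : Matrix (x × γ × δ) (x × γ × δ) ℂ) : Matrix (γ × δ) (γ × δ) ℂ :=
  fun u v => ∑ X : x, ρ (X, u) (X, v)

/-- The marginal ρ_C of a state on X ⊗ C ⊗ D. -/
def mC (ρ : Matrix (x × γ × δ) (x × γ × δ) ℂ) : Matrix γ γ ℂ :=
  fun i j => ∑ X : x, ∑ w : δ, ρ (X, i, w) (X, j, w)

/-- The quantum conditional mutual information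
I(X:D|C) = H(ρ_XC) + H(ρ_CD) - H(ρ_XCD) - H(ρ_C). -/
def qcmiXD_C (ρ : Matrix (x × γ × δ) (x × γ × δ) ℂ) : ℝ :=
  vnEntropy (mXC ρ) + vnEntropy (mCD ρ) - vnEntropy ρ - vnEntropy (mC ρ)

end QCMI


set_option linter.all false
set_option linter.unusedSectionVars false

section RepTheory

/-- A spectral representation of a Hermitian matrix: `A = U diag(p) Uᴴ` with `U` unitary. -/
structure SpecRep {n : Type*} [Fintype n] [DecidableEq n] (A U : Matrix n n ℂ) (p : n → ℝ) : Prop where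
  left : Uᴴ * U = 1
  right : U * Uᴴ = 1
  eq : A = U * diagonal (fun i => (p i : ℂ)) * Uᴴ

variable {n : Type*} [Fintype n] [DecidableEq n]

theorem rep_exists {A : Matrix n n ℂ} (hA : A.IsHermitian) :
    SpecRep A (hA.eigenvectorUnitary : Matrix n n ℂ) hA.eigenvalues := by
  refine ⟨?_, ?_, ?_⟩
  · exact Unitary.coe_star_mul_self hA.eigenvectorUnitary
  · exact Unitary.coe_mul_star_self hA.eigenvectorUnitary
  · have := hA.spectral_theorem
    rw [Unitary.conjStarAlgAut_apply] at this
    exact this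

theorem SpecRep.isHermitian {A U : Matrix n n ℂ} {p : n → ℝ} (h : SpecRep A U p) : A.IsHermitian := by
  rw [h.eq, Matrix.IsHermitian]
  simp only [conjTranspose_mul, conjTranspose_conjTranspose, diagonal_conjTranspose, Matrix.mul_assoc]
  congr 3
  ext i; simp

theorem SpecRep.charpoly {A U : Matrix n n ℂ} {p : n → ℝ} (h : SpecRep A U p) :
    A.charpoly = ∏ i, (Polynomial.X - Polynomial.C ((p i : ℝ) : ℂ)) := by
  rw [h.eq, Matrix.charpoly_mul_comm, ← Matrix.mul_assoc, h.left, Matrix.one_mul,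
    Matrix.charpoly_diagonal]

theorem sum_eigenvalues_of_charpoly {m : Type*} [Fintype m] {A : Matrix n n ℂ} {p : m → ℝ}
    (h : A.charpoly = ∏ i, (Polynomial.X - Polynomial.C ((p i : ℝ) : ℂ)))
    (hA : A.IsHermitian) (f : ℝ → ℝ) :
    ∑ i, f (hA.eigenvalues i) = ∑ i, f (p i) := by
  have h1 := hA.roots_charpoly_eq_eigenvalues
  have h0 : (∏ i, (Polynomial.X - Polynomial.C ((p i : ℝ) : ℂ))).roots =
      Multiset.map (fun i => ((p i : ℝ) : ℂ)) Finset.univ.val := by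
    have := Polynomial.roots_multiset_prod_X_sub_C (Multiset.map (fun i => ((p i : ℝ) : ℂ)) Finset.univ.val)
    rw [Multiset.map_map] at this
    exact this
  rw [h, h0] at h1
  have h2 := congrArg (fun s => (s.map (fun z : ℂ => f z.re)).sum) h1
  simp only [Multiset.map_map, Function.comp_def] at h2
  exact h2.symm

theorem SpecRep.sum_eq {A U : Matrix n n ℂ} {p : n → ℝ} (h : SpecRep A U p) (hA : A.IsHermitian)
    (f : ℝ → ℝ) : ∑ i, f (hA.eigenvalues i) = ∑ i, f (p i) :=
  sum_eigenvalues_of_charpoly h.charpoly hA f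

theorem SpecRep.entropy {A U : Matrix n n ℂ} {p : n → ℝ} (h : SpecRep A U p) :
    vnEntropy A = ∑ i, Real.negMulLog (p i) := by
  rw [vnEntropy, dif_pos h.isHermitian, h.sum_eq]

theorem SpecRep.traceNorm_eq {A U : Matrix n n ℂ} {p : n → ℝ} (h : SpecRep A U p) :
    traceNorm A = ∑ i, |p i| := by
  have h2 : SpecRep (Aᴴ * A) U (fun i => p i ^ 2) := by
    refine ⟨h.left, h.right, ?_⟩
    rw [h.isHermitian.eq]
    conv_lhs => rw [h.eq]
    calc U * diagonal (fun i => (p i : ℂ)) * Uᴴ * (U * diagonal (fun i => (p i : ℂ)) * Uᴴ)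
        = U * diagonal (fun i => (p i : ℂ)) * (Uᴴ * U) * diagonal (fun i => (p i : ℂ)) * Uᴴ := by
          simp only [Matrix.mul_assoc]
      _ = _ := by
          rw [h.left, Matrix.mul_one, Matrix.mul_assoc U, diagonal_mul_diagonal]
          simp [pow_two]
  rw [traceNorm, h2.sum_eq]
  simp [Real.sqrt_sq_eq_abs]

theorem SpecRep.conj {A U : Matrix n n ℂ} {p : n → ℝ} (h : SpecRep A U p) :
    Uᴴ * A * U = diagonal (fun i => (p i : ℂ)) := by
  rw [h.eq]
  calc Uᴴ * (U * diagonal (fun i => (p i : ℂ)) * Uᴴ) * U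
      = (Uᴴ * U) * diagonal (fun i => (p i : ℂ)) * (Uᴴ * U) := by simp only [Matrix.mul_assoc]
    _ = _ := by rw [h.left]; simp

theorem SpecRep.nonneg {A U : Matrix n n ℂ} {p : n → ℝ} (h : SpecRep A U p) (hA : A.PosSemidef) (i : n) :
    0 ≤ p i := by
  have h1 := hA.conjTranspose_mul_mul_same U
  rw [h.conj, posSemidef_diagonal_iff] at h1
  exact_mod_cast h1 i

theorem SpecRep.posSemidef {A U : Matrix n n ℂ} {p : n → ℝ} (h : SpecRep A U p) (hp : ∀ i, 0 ≤ p i) :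
    A.PosSemidef := by
  rw [h.eq]
  refine PosSemidef.mul_mul_conjTranspose_same ?_ U
  rw [posSemidef_diagonal_iff]
  intro i; exact_mod_cast hp i

theorem SpecRep.trace {A U : Matrix n n ℂ} {p : n → ℝ} (h : SpecRep A U p) :
    A.trace.re = ∑ i, p i := by
  rw [h.eq, Matrix.trace_mul_comm, ← Matrix.mul_assoc, h.left, Matrix.one_mul]
  simp [Matrix.trace]

/-- The entropy is invariant under relabelling. -/
theorem vnEntropy_submatrix {m : Type*} [Fintype m] [DecidableEq m] (A : Matrix n n ℂ) (e : m ≃ n) :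
    vnEntropy (A.submatrix e e) = vnEntropy A := by
  by_cases h : A.IsHermitian
  · have h' : (A.submatrix e e).IsHermitian := h.submatrix e
    rw [vnEntropy, vnEntropy, dif_pos h, dif_pos h']
    refine sum_eigenvalues_of_charpoly ?_ h' _
    rw [← (rep_exists h).charpoly]
    exact Matrix.charpoly_reindex e.symm A
  · have h' : ¬ (A.submatrix e e).IsHermitian := by
      intro h'
      apply h
      have := h'.submatrix e.symm
      simpa using this
    rw [vnEntropy, vnEntropy, dif_neg h, dif_neg h']

theorem traceNorm_submatrix {m : Type*} [Fintype m] [DecidableEq m] (A : Matrix n n ℂ) (e : m ≃ n) :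
    traceNorm (A.submatrix e e) = traceNorm A := by
  rw [traceNorm, traceNorm]
  refine sum_eigenvalues_of_charpoly ?_ _ (fun x => Real.sqrt x)
  rw [← (rep_exists (posSemidef_conjTranspose_mul_self A).1).charpoly]
  have : (A.submatrix e e)ᴴ * A.submatrix e e = (Aᴴ * A).submatrix e e := by
    rw [conjTranspose_submatrix, submatrix_mul_equiv]
  rw [this]
  exact Matrix.charpoly_reindex e.symm (Aᴴ * A)

/-- overlap weights -/
def ovl (U V : Matrix n n ℂ) (i j : n) : ℝ := Complex.normSq ((Uᴴ * V) i j)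

theorem ovl_nonneg (U V : Matrix n n ℂ) (i j : n) : 0 ≤ ovl U V i j := Complex.normSq_nonneg _

theorem sum_normSq_of_unitary {W : Matrix n n ℂ} (h : W * Wᴴ = 1) (i : n) :
    ∑ j, Complex.normSq (W i j) = 1 := by
  have := congrFun (congrFun h i) i
  rw [Matrix.mul_apply] at this
  have h2 := congrArg Complex.re this
  simpa [Complex.mul_conj, -Complex.mul_re] using h2

theorem ovl_sum_right {U V : Matrix n n ℂ} (hU : Uᴴ * U = 1) (hV : V * Vᴴ = 1) (i : n) :
    ∑ j, ovl U V i j = 1 := by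
  apply sum_normSq_of_unitary (W := Uᴴ * V)
  rw [conjTranspose_mul, conjTranspose_conjTranspose, Matrix.mul_assoc, ← Matrix.mul_assoc V, hV,
    Matrix.one_mul, hU]

theorem ovl_sum_left {U V : Matrix n n ℂ} (hU : U * Uᴴ = 1) (hV : Vᴴ * V = 1) (j : n) :
    ∑ i, ovl U V i j = 1 := by
  have := ovl_sum_right (U := V) (V := U) hV hU j
  rw [← this]
  refine Finset.sum_congr rfl fun i _ => ?_
  have h : Uᴴ * V = (Vᴴ * U)ᴴ := by simp
  rw [ovl, ovl, h, conjTranspose_apply]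
  simp

theorem SpecRep.diag_conj {A U : Matrix n n ℂ} {p : n → ℝ} (h : SpecRep A U p) (V : Matrix n n ℂ) (j : n) :
    ((Vᴴ * A * V) j j).re = ∑ i, p i * ovl U V i j := by
  have : Vᴴ * A * V = (Uᴴ * V)ᴴ * diagonal (fun i => (p i : ℂ)) * (Uᴴ * V) := by
    rw [h.eq]; simp only [conjTranspose_mul, conjTranspose_conjTranspose, Matrix.mul_assoc]
  rw [this, Matrix.mul_apply, Complex.re_sum]
  refine Finset.sum_congr rfl fun i _ => ?_
  rw [Matrix.mul_diagonal, conjTranspose_apply, ovl, Complex.normSq_apply]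
  simp
  ring

/-- cross entropy `-Tr A log B`, where `B = V diag(q) Vᴴ`. -/
def crossE (A V : Matrix n n ℂ) (q : n → ℝ) : ℝ := - ∑ j, ((Vᴴ * A * V) j j).re * Real.log (q j)

theorem crossE_self {B V : Matrix n n ℂ} {q : n → ℝ} (h : SpecRep B V q) :
    crossE B V q = vnEntropy B := by
  rw [crossE, h.conj, h.entropy, ← Finset.sum_neg_distrib]
  refine Finset.sum_congr rfl fun i _ => ?_
  simp [Real.negMulLog]

theorem crossE_add (A B V : Matrix n n ℂ) (q : n → ℝ) :
    crossE (A + B) V q = crossE A V q + crossE B V q := by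
  simp only [crossE, Matrix.mul_add, Matrix.add_mul, Matrix.add_apply, Complex.add_re, add_mul,
    Finset.sum_add_distrib]
  ring

theorem SpecRep.crossE_eq {A U : Matrix n n ℂ} {p : n → ℝ} (h : SpecRep A U p) (V : Matrix n n ℂ)
    (q : n → ℝ) : crossE A V q = - ∑ i, ∑ j, ovl U V i j * (p i * Real.log (q j)) := by
  rw [crossE, Finset.sum_comm]
  congr 1
  refine Finset.sum_congr rfl fun j _ => ?_
  rw [h.diag_conj, Finset.sum_mul]
  refine Finset.sum_congr rfl fun i _ => ?_
  ring

/-- support condition -/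
theorem supp_of_dom {A B U V : Matrix n n ℂ} {p q : n → ℝ} (hA : SpecRep A U p) (hB : SpecRep B V q)
    (hp : ∀ i, 0 ≤ p i) {k : ℝ} (hd : ((k : ℂ) • B - A).PosSemidef) (i j : n) (hq : q j = 0) :
    ovl U V i j = 0 ∨ p i = 0 := by
  have h1 := (hd.conjTranspose_mul_mul_same V).diag_nonneg (i := j)
  rw [Matrix.mul_sub, Matrix.sub_mul, Matrix.mul_smul, Matrix.smul_mul, hB.conj] at h1
  have h2 := (Complex.le_def.1 h1).1
  simp [hq] at h2
  rw [hA.diag_conj] at h2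
  have h3 : ∑ i, p i * ovl U V i j = 0 :=
    le_antisymm h2 (Finset.sum_nonneg fun i _ => mul_nonneg (hp i) (ovl_nonneg _ _ _ _))
  rw [Finset.sum_eq_zero_iff_of_nonneg
    (fun i _ => mul_nonneg (hp i) (ovl_nonneg _ _ _ _))] at h3
  rcases mul_eq_zero.1 (h3 i (Finset.mem_univ i)) with h | h
  · right; exact h
  · left; exact h

theorem SpecRep.entropy_ovl {A U : Matrix n n ℂ} {p : n → ℝ} (h : SpecRep A U p) {V : Matrix n n ℂ}
    (hV : V * Vᴴ = 1) :
    vnEntropy A = - ∑ i, ∑ j, ovl U V i j * (p i * Real.log (p i)) := by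
  rw [h.entropy, ← Finset.sum_neg_distrib]
  refine Finset.sum_congr rfl fun i _ => ?_
  rw [← Finset.sum_mul, ovl_sum_right h.left hV, Real.negMulLog]
  ring

theorem SpecRep.trace_ovl {A U : Matrix n n ℂ} {p : n → ℝ} (h : SpecRep A U p) {V : Matrix n n ℂ}
    (hV : V * Vᴴ = 1) :
    A.trace.re = ∑ i, ∑ j, ovl U V i j * p i := by
  rw [h.trace]
  refine Finset.sum_congr rfl fun i _ => ?_
  rw [← Finset.sum_mul, ovl_sum_right h.left hV, one_mul]

theorem SpecRep.trace_ovl' {B V : Matrix n n ℂ} {q : n → ℝ} (h : SpecRep B V q) {U : Matrix n n ℂ}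
    (hU : U * Uᴴ = 1) :
    B.trace.re = ∑ i, ∑ j, ovl U V i j * q j := by
  rw [h.trace, Finset.sum_comm]
  refine Finset.sum_congr rfl fun i _ => ?_
  rw [← Finset.sum_mul, ovl_sum_left hU h.left, one_mul]

theorem scalar_klein {p q c : ℝ} (hp : 0 ≤ p) (hq : 0 < q) (hc : 0 < c) :
    p * Real.log c + p - c * q ≤ p * Real.log p - p * Real.log q := by
  rcases hp.eq_or_lt with rfl | hp
  · simp; positivity
  · have := Real.log_le_sub_one_of_pos (x := c * q / p) (by positivity)
    rw [Real.log_div (by positivity) (by positivity), Real.log_mul (by positivity) (by positivity)]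
      at this
    have h2 := mul_le_mul_of_nonneg_left this hp.le
    have h3 : p * (c * q / p - 1) = c * q - p := by field_simp
    rw [h3] at h2
    nlinarith

theorem klein {A B V : Matrix n n ℂ} {q : n → ℝ} (hA : A.PosSemidef) (hB : B.PosSemidef)
    (hr : SpecRep B V q) {k : ℝ} (hd : ((k : ℂ) • B - A).PosSemidef) {c : ℝ} (hc : 0 < c) :
    vnEntropy A + A.trace.re * Real.log c + A.trace.re - c * B.trace.re ≤ crossE A V q := by
  have hA' := rep_exists hA.1
  set U := (hA.1.eigenvectorUnitary : Matrix n n ℂ)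
  set p := hA.1.eigenvalues
  have hp := hA'.nonneg hA
  have hq := hr.nonneg hB
  rw [hA'.crossE_eq, hA'.entropy_ovl hr.right, hA'.trace_ovl hr.right, hr.trace_ovl' hA'.right]
  have key : ∑ i, ∑ j, ovl U V i j * (p i * Real.log c + p i - c * q j) ≤
      ∑ i, ∑ j, ovl U V i j * (p i * Real.log (p i) - p i * Real.log (q j)) := by
    refine Finset.sum_le_sum fun i _ => Finset.sum_le_sum fun j _ => ?_
    rcases (hq j).eq_or_lt with h0 | h0
    · rcases supp_of_dom hA' hr hp hd i j h0.symm with h | h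
      · simp [h]
      · simp [h, ← h0]
    · exact mul_le_mul_of_nonneg_left (scalar_klein (hp i) h0 hc) (ovl_nonneg _ _ _ _)
  have e1 : ∑ i, ∑ j, ovl U V i j * (p i * Real.log c + p i - c * q j) =
      (∑ i, ∑ j, ovl U V i j * p i) * Real.log c + (∑ i, ∑ j, ovl U V i j * p i)
        - c * ∑ i, ∑ j, ovl U V i j * q j := by
    simp only [mul_sub, mul_add, Finset.sum_sub_distrib, Finset.sum_add_distrib, Finset.sum_mul,
      Finset.mul_sum]
    congr 1
    · congr 1
      refine Finset.sum_congr rfl fun i _ => Finset.sum_congr rfl fun j _ => ?_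
      ring
    · refine Finset.sum_congr rfl fun i _ => Finset.sum_congr rfl fun j _ => ?_
      ring
  have e2 : ∑ i, ∑ j, ovl U V i j * (p i * Real.log (p i) - p i * Real.log (q j)) =
      (∑ i, ∑ j, ovl U V i j * (p i * Real.log (p i)))
        - ∑ i, ∑ j, ovl U V i j * (p i * Real.log (q j)) := by
    simp only [mul_sub, Finset.sum_sub_distrib]
  rw [e1, e2] at key
  linarith

end RepTheory

section Ineqs

variable {n : Type*} [Fintype n] [DecidableEq n]

theorem conj_diag_bound {A B V U : Matrix n n ℂ} {p q : n → ℝ} (hA : SpecRep A U p)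
    (hp : ∀ i, 0 ≤ p i)
    (hr : SpecRep B V q) {k : ℝ} (hd : ((k : ℂ) • B - A).PosSemidef)
    (i : n) : p i * (∑ j, ovl U V i j * (q j)⁻¹) ^ 2 ≤ k * ∑ j, ovl U V i j * (q j)⁻¹ := by
  set W := Uᴴ * V with hW
  set D : Matrix n n ℂ := diagonal (fun j => (((q j)⁻¹ : ℝ) : ℂ)) with hD
  set H := W * D * Wᴴ with hH
  have hDs : Dᴴ = D := by
    rw [hD, diagonal_conjTranspose]; congr 1; ext j; simp
  have hHs : Hᴴ = H := by
    rw [hH]; simp only [conjTranspose_mul, conjTranspose_conjTranspose, hDs, Matrix.mul_assoc]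
  have hWs : Wᴴ = Vᴴ * U := by simp [hW]
  have hDD : D * diagonal (fun j => (q j : ℂ)) * D = D := by
    rw [hD, diagonal_mul_diagonal, diagonal_mul_diagonal]
    congr 1; ext j
    by_cases h : q j = 0
    · simp [h]
    · have : (q j : ℂ) ≠ 0 := by exact_mod_cast h
      push_cast; field_simp
  have hY := (hd.conjTranspose_mul_mul_same (V * D * Vᴴ * U)).diag_nonneg (i := i)
  have hYs : (V * D * Vᴴ * U)ᴴ = Uᴴ * V * D * Vᴴ := by
    simp only [conjTranspose_mul, conjTranspose_conjTranspose, hDs, Matrix.mul_assoc]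
  have e1 : (V * D * Vᴴ * U)ᴴ * B * (V * D * Vᴴ * U) = H := by
    rw [hYs, hr.eq]
    calc _ = Uᴴ * V * D * (Vᴴ * V) * diagonal (fun j => (q j : ℂ)) * (Vᴴ * V) * D * Vᴴ * U := by
            simp only [Matrix.mul_assoc]
      _ = Uᴴ * V * (D * diagonal (fun j => (q j : ℂ)) * D) * Vᴴ * U := by
            rw [hr.left]; simp only [Matrix.mul_one, Matrix.mul_assoc]
      _ = H := by rw [hDD, hH, hWs, hW]; simp only [Matrix.mul_assoc]
  have e2 : (V * D * Vᴴ * U)ᴴ * A * (V * D * Vᴴ * U) = H * diagonal (fun j => (p j : ℂ)) * Hᴴ := by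
    rw [hYs, hA.eq, hHs, hH, hWs, hW]
    simp only [Matrix.mul_assoc]
  rw [Matrix.mul_sub, Matrix.sub_mul, Matrix.mul_smul, Matrix.smul_mul, e1, e2] at hY
  have hYr := (Complex.le_def.1 hY).1
  have hHii : H i i = ((∑ j, ovl U V i j * (q j)⁻¹ : ℝ) : ℂ) := by
    rw [hH, Matrix.mul_apply]
    push_cast
    refine Finset.sum_congr rfl fun j _ => ?_
    rw [hD, Matrix.mul_diagonal, conjTranspose_apply, ovl, ← hW]
    simp only [RCLike.star_def]
    rw [← Complex.mul_conj]; push_cast; ring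
  have hsum : ((H * diagonal (fun j => (p j : ℂ)) * Hᴴ) i i).re = ∑ l, p l * Complex.normSq (H i l) := by
    rw [Matrix.mul_apply, Complex.re_sum]
    refine Finset.sum_congr rfl fun l _ => ?_
    rw [Matrix.mul_diagonal, conjTranspose_apply, Complex.normSq_apply]
    simp; ring
  have hle : p i * Complex.normSq (H i i) ≤ ∑ l, p l * Complex.normSq (H i l) :=
    Finset.single_le_sum (f := fun l => p l * Complex.normSq (H i l))
      (fun l _ => mul_nonneg (hp l) (Complex.normSq_nonneg _)) (Finset.mem_univ i)
  rw [Matrix.sub_apply, Matrix.smul_apply, Complex.sub_re, hsum, hHii] at hYr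
  rw [hHii, Complex.normSq_ofReal] at hle
  simp only [smul_eq_mul, Complex.re_ofReal_mul, Complex.ofReal_re, Complex.zero_re] at hYr
  nlinarith

theorem crossE_le {A B V : Matrix n n ℂ} {q : n → ℝ} (hA : A.PosSemidef) (hB : B.PosSemidef)
    (hr : SpecRep B V q) {k : ℝ} (hk : 0 < k) (hd : ((k : ℂ) • B - A).PosSemidef) :
    crossE A V q ≤ vnEntropy A + A.trace.re * Real.log k := by
  have hA' := rep_exists hA.1
  set U := (hA.1.eigenvectorUnitary : Matrix n n ℂ)
  set p := hA.1.eigenvalues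
  have hp := hA'.nonneg hA
  have hq := hr.nonneg hB
  rw [hA'.crossE_eq, hA'.entropy, hA'.trace, ← Finset.sum_neg_distrib, Finset.sum_mul,
    ← Finset.sum_add_distrib]
  refine Finset.sum_le_sum fun i _ => ?_
  rcases (hp i).eq_or_lt with h0 | h0
  · simp [← h0]
  set r := ∑ j, ovl U V i j * (q j)⁻¹ with hrr
  have hr0 : 0 ≤ r := Finset.sum_nonneg fun j _ =>
    mul_nonneg (ovl_nonneg _ _ _ _) (inv_nonneg.2 (hq j))
  have hb := conj_diag_bound hA' hp hr hd i
  rw [← hrr] at hb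
  have hpr : p i * r ≤ k := by
    rcases hr0.eq_or_lt with h | h
    · rw [← h]; simpa using hk.le
    · exact le_of_mul_le_mul_right (by nlinarith) h
  have key : ∀ j, -(ovl U V i j * (p i * Real.log (q j))) ≤
      p i * (p i / k * (ovl U V i j * (q j)⁻¹) - ovl U V i j - Real.log (p i / k) * ovl U V i j) := by
    intro j
    rcases (hq j).eq_or_lt with h | h
    · rcases supp_of_dom hA' hr hp hd i j h.symm with h' | h'
      · simp [h']
      · exact absurd h' h0.ne'
    · have := Real.log_le_sub_one_of_pos (x := p i / k * (q j)⁻¹) (by positivity)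
      rw [Real.log_mul (by positivity) (by positivity), Real.log_inv] at this
      have h2 := mul_le_mul_of_nonneg_left this (mul_nonneg h0.le (ovl_nonneg U V i j))
      nlinarith
  have h3 := Finset.sum_le_sum fun j (_ : j ∈ Finset.univ) => key j
  rw [← Finset.mul_sum, Finset.sum_sub_distrib, Finset.sum_sub_distrib, ← Finset.mul_sum,
    ← Finset.mul_sum, ovl_sum_right hA'.left hr.right, ← hrr, Finset.sum_neg_distrib] at h3
  refine h3.trans ?_
  rw [Real.log_div h0.ne' hk.ne', Real.negMulLog]
  have h4 : p i / k * r ≤ 1 := by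
    rw [div_mul_eq_mul_div, div_le_one hk]; exact hpr
  nlinarith

/-- scalar integrand -/
def phiI (p q s : ℝ) : ℝ := (p - q) ^ 2 * (1 - s) / ((1 - s) * q + s * p)

theorem phiI_integral {p q : ℝ} (hp : 0 ≤ p) (hq : 0 ≤ q) (h : q = 0 → p = 0) :
    IntervalIntegrable (phiI p q) MeasureTheory.volume 0 1 ∧
    ∫ s in (0:ℝ)..1, phiI p q s = p * Real.log p - p * Real.log q - p + q := by
  rcases hq.eq_or_lt with h0 | h0
  · have hp0 := h h0.symm
    subst hp0; subst h0
    have : phiI 0 0 = fun _ => (0:ℝ) := by funext s; simp [phiI]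
    rw [this]; simp
  rcases hp.eq_or_lt with h1 | h1
  · subst h1
    have hae : ∀ s ∈ Set.Ioo (0:ℝ) 1, phiI 0 q s = q := by
      intro s hs
      have : 1 - s ≠ 0 := by linarith [hs.2]
      simp only [phiI]; field_simp; ring
    have hEq : Set.EqOn (fun _ => q) (phiI 0 q) (Set.Ioo (0:ℝ) 1) := fun s hs => (hae s hs).symm
    constructor
    · rw [intervalIntegrable_iff_integrableOn_Ioo_of_le zero_le_one]
      refine MeasureTheory.IntegrableOn.congr_fun ?_ hEq measurableSet_Ioo
      simp
    · rw [intervalIntegral.integral_of_le zero_le_one,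
        MeasureTheory.integral_Ioc_eq_integral_Ioo,
        ← MeasureTheory.setIntegral_congr_fun measurableSet_Ioo hEq]
      simp
  · have hpos : ∀ s ∈ Set.uIcc (0:ℝ) 1, 0 < (1 - s) * q + s * p := by
      intro s hs
      rw [Set.uIcc_of_le zero_le_one] at hs
      rcases hs.1.eq_or_lt with h | h
      · rw [← h]; simpa using h0
      · have := mul_pos h h1
        have := mul_nonneg (sub_nonneg.2 hs.2) h0.le
        linarith
    have hIntg : IntervalIntegrable (phiI p q) MeasureTheory.volume 0 1 := by
      apply ContinuousOn.intervalIntegrable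
      unfold phiI
      apply ContinuousOn.div
      · fun_prop
      · fun_prop
      · intro s hs; exact (hpos s hs).ne'
    refine ⟨hIntg, ?_⟩
    rw [intervalIntegral.integral_eq_sub_of_hasDerivAt
      (f := fun s => p * Real.log ((1 - s) * q + s * p) - ((1 - s) * q + s * p)) _ hIntg]
    · simp; ring
    · intro s hs
      have hd : HasDerivAt (fun s : ℝ => (1 - s) * q + s * p) (p - q) s := by
        have h1 := ((hasDerivAt_id s).const_sub 1).mul_const q
        have h2 := (hasDerivAt_id s).mul_const p
        have := h1.add h2
        convert! this using 1
        ring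
      have := ((hd.log (hpos s hs).ne').const_mul p).sub hd
      convert! this using 1
      have := (hpos s hs).ne'
      simp only [phiI]
      rw [← mul_div_assoc, div_eq_iff this, sub_mul, div_mul_cancel₀ _ this]
      ring

end Ineqs

section DPI

variable {n : Type*} [Fintype n] [DecidableEq n]

/-- variational functional -/
def varF (A B Y : Matrix n n ℂ) (s : ℝ) : ℝ :=
  2 * ((A * Y).trace - (B * Y).trace).re - (1 - s) * (B * (Y * Yᴴ)).trace.re
    - s * (A * (Yᴴ * Y)).trace.re

/-- the optimal value in coordinates -/
def optQ (U V : Matrix n n ℂ) (p q : n → ℝ) (s : ℝ) : ℝ :=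
  ∑ i, ∑ j, ovl U V i j * ((p i - q j) ^ 2 / ((1 - s) * q j + s * p i))

theorem trace_diag_mul_mul (d : n → ℝ) (X Y : Matrix n n ℂ) :
    (diagonal (fun i => (d i : ℂ)) * (X * Y)).trace.re = ∑ i, ∑ j, d i * (X i j * Y j i).re := by
  rw [Matrix.trace, Complex.re_sum]
  refine Finset.sum_congr rfl fun i _ => ?_
  rw [Matrix.diag_apply, Matrix.diagonal_mul, Complex.re_ofReal_mul, Matrix.mul_apply, Complex.re_sum,
    Finset.mul_sum]

theorem varF_coord {A B U V : Matrix n n ℂ} {p q : n → ℝ} (hA : SpecRep A U p) (hB : SpecRep B V q)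
    (Z : Matrix n n ℂ) (s : ℝ) :
    varF A B (V * Z * Uᴴ) s = ∑ i, ∑ j, (2 * (p i - q j) * ((Uᴴ * V) i j * Z j i).re
      - ((1 - s) * q j + s * p i) * Complex.normSq (Z j i)) := by
  set P : Matrix n n ℂ := diagonal (fun i => (p i : ℂ)) with hP
  set Q : Matrix n n ℂ := diagonal (fun i => (q i : ℂ)) with hQ
  have e1 : (A * (V * Z * Uᴴ)).trace = (P * ((Uᴴ * V) * Z)).trace := by
    rw [hA.eq]
    calc _ = (U * (P * Uᴴ * V * Z * Uᴴ)).trace := by simp only [Matrix.mul_assoc]; rfl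
      _ = (P * Uᴴ * V * Z * (Uᴴ * U)).trace := by
        rw [Matrix.trace_mul_comm]; simp only [Matrix.mul_assoc]
      _ = _ := by rw [hA.left, Matrix.mul_one]; simp only [Matrix.mul_assoc]
  have e2 : (B * (V * Z * Uᴴ)).trace = (Q * (Z * (Uᴴ * V))).trace := by
    rw [hB.eq]
    calc _ = (V * (Q * (Vᴴ * V) * Z * Uᴴ)).trace := by simp only [Matrix.mul_assoc]; rfl
      _ = _ := by
        rw [Matrix.trace_mul_comm, hB.left]; simp only [Matrix.mul_assoc, Matrix.one_mul]
  have hYs : (V * Z * Uᴴ)ᴴ = U * Zᴴ * Vᴴ := by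
    simp only [conjTranspose_mul, conjTranspose_conjTranspose, Matrix.mul_assoc]
  have e3 : (B * ((V * Z * Uᴴ) * (V * Z * Uᴴ)ᴴ)).trace = (Q * (Z * Zᴴ)).trace := by
    rw [hYs, hB.eq]
    calc _ = (V * (Q * (Vᴴ * V) * Z * (Uᴴ * U) * Zᴴ * Vᴴ)).trace := by
            simp only [Matrix.mul_assoc]; rfl
      _ = (Q * (Vᴴ * V) * Z * (Uᴴ * U) * Zᴴ * (Vᴴ * V)).trace := by
        rw [Matrix.trace_mul_comm]; simp only [Matrix.mul_assoc]
      _ = _ := by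
        rw [hA.left, hB.left]; simp only [Matrix.mul_assoc, Matrix.one_mul, Matrix.mul_one]
  have e4 : (A * ((V * Z * Uᴴ)ᴴ * (V * Z * Uᴴ))).trace = (P * (Zᴴ * Z)).trace := by
    rw [hYs, hA.eq]
    calc _ = (U * (P * (Uᴴ * U) * Zᴴ * (Vᴴ * V) * Z * Uᴴ)).trace := by
            simp only [Matrix.mul_assoc]; rfl
      _ = (P * (Uᴴ * U) * Zᴴ * (Vᴴ * V) * Z * (Uᴴ * U)).trace := by
        rw [Matrix.trace_mul_comm]; simp only [Matrix.mul_assoc]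
      _ = _ := by
        rw [hA.left, hB.left]; simp only [Matrix.mul_assoc, Matrix.one_mul, Matrix.mul_one]
  rw [varF, e1, e2, e3, e4, Complex.sub_re, trace_diag_mul_mul, trace_diag_mul_mul,
    trace_diag_mul_mul, trace_diag_mul_mul]
  rw [Finset.sum_comm (f := fun i j => q i * (Z i j * (Uᴴ * V) j i).re),
    Finset.sum_comm (f := fun i j => q i * (Z i j * Zᴴ j i).re),
    ← Finset.sum_sub_distrib, Finset.mul_sum, Finset.mul_sum, Finset.mul_sum,
    ← Finset.sum_sub_distrib, ← Finset.sum_sub_distrib]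
  refine Finset.sum_congr rfl fun i _ => ?_
  rw [← Finset.sum_sub_distrib, Finset.mul_sum, Finset.mul_sum, Finset.mul_sum,
    ← Finset.sum_sub_distrib, ← Finset.sum_sub_distrib]
  refine Finset.sum_congr rfl fun j _ => ?_
  have h1 : (Z j i * Zᴴ i j).re = Complex.normSq (Z j i) := by
    rw [conjTranspose_apply, RCLike.star_def, Complex.mul_conj]; simp
  have h2 : (Zᴴ i j * Z j i).re = Complex.normSq (Z j i) := by
    rw [mul_comm, h1]
  rw [h1, h2, mul_comm (Z j i) ((Uᴴ * V) i j)]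
  ring

theorem varF_le {A B U V : Matrix n n ℂ} {p q : n → ℝ} (hA : SpecRep A U p) (hB : SpecRep B V q)
    (hp : ∀ i, 0 ≤ p i) (hq : ∀ i, 0 ≤ q i) (Y : Matrix n n ℂ) {s : ℝ} (hs0 : 0 < s) (hs1 : s < 1) :
    varF A B Y s ≤ optQ U V p q s := by
  have hY : Y = V * (Vᴴ * Y * U) * Uᴴ := by
    calc Y = (V * Vᴴ) * Y * (U * Uᴴ) := by rw [hA.right, hB.right]; simp
      _ = _ := by simp only [Matrix.mul_assoc]
  rw [hY, varF_coord hA hB, optQ]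
  refine Finset.sum_le_sum fun i _ => Finset.sum_le_sum fun j _ => ?_
  generalize (Vᴴ * Y * U) j i = z
  rw [ovl]
  generalize (Uᴴ * V) i j = w
  have hpi := hp i
  have hqj := hq j
  generalize p i = x at *
  generalize q j = y at *
  have h1 : 0 ≤ (1 - s) * y := mul_nonneg (by linarith) hqj
  have h2 : 0 ≤ s * x := mul_nonneg hs0.le hpi
  rcases (add_nonneg h1 h2).eq_or_lt with h | h
  · have hx : s * x = 0 := by linarith
    have hy : (1 - s) * y = 0 := by linarith
    have hx' : x = 0 := by
      rcases mul_eq_zero.1 hx with h | h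
      · linarith
      · exact h
    have hy' : y = 0 := by
      rcases mul_eq_zero.1 hy with h | h
      · linarith
      · exact h
    simp [hx', hy']
  · set c := (1 - s) * y + s * x
    rw [← mul_div_assoc, le_div_iff₀ h, Complex.normSq_apply, Complex.normSq_apply, Complex.mul_re]
    nlinarith [sq_nonneg (c * z.re - (x - y) * w.re), sq_nonneg (c * z.im + (x - y) * w.im)]

theorem varF_attained {A B U V : Matrix n n ℂ} {p q : n → ℝ} (hA : SpecRep A U p)
    (hB : SpecRep B V q) (s : ℝ) :
    ∃ Y, varF A B Y s = optQ U V p q s := by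
  refine ⟨V * (Matrix.of fun j i => (((p i - q j) / ((1 - s) * q j + s * p i) : ℝ) : ℂ)
    * star ((Uᴴ * V) i j)) * Uᴴ, ?_⟩
  rw [varF_coord hA hB, optQ]
  refine Finset.sum_congr rfl fun i _ => Finset.sum_congr rfl fun j _ => ?_
  rw [ovl, Matrix.of_apply]
  generalize (Uᴴ * V) i j = w
  generalize p i = x
  generalize q j = y
  generalize (1 - s) * y + s * x = c
  rw [Complex.normSq_apply, Complex.normSq_apply]
  by_cases hc : c = 0
  · simp [hc]
  · simp
    field_simp
    ring

theorem relEnt_eq_integral {A B V : Matrix n n ℂ} {q : n → ℝ} {U : Matrix n n ℂ} {p : n → ℝ}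
    (hA : SpecRep A U p) (hr : SpecRep B V q) (hp : ∀ i, 0 ≤ p i) (hq : ∀ i, 0 ≤ q i)
    {k : ℝ} (hd : ((k : ℂ) • B - A).PosSemidef) :
    IntervalIntegrable (fun s => (1 - s) * optQ U V p q s) MeasureTheory.volume 0 1 ∧
    crossE A V q - vnEntropy A = A.trace.re - B.trace.re
      + ∫ s in (0:ℝ)..1, (1 - s) * optQ U V p q s := by
  have hfun : (fun s => (1 - s) * optQ U V p q s) =
      fun s => ∑ i, ∑ j, ovl U V i j * phiI (p i) (q j) s := by
    funext s
    rw [optQ, Finset.mul_sum]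
    refine Finset.sum_congr rfl fun i _ => ?_
    rw [Finset.mul_sum]
    refine Finset.sum_congr rfl fun j _ => ?_
    rw [phiI]; ring
  have hterm : ∀ i j, IntervalIntegrable (fun s => ovl U V i j * phiI (p i) (q j) s)
      MeasureTheory.volume 0 1 ∧ ∫ s in (0:ℝ)..1, ovl U V i j * phiI (p i) (q j) s =
        ovl U V i j * (p i * Real.log (p i) - p i * Real.log (q j) - p i + q j) := by
    intro i j
    by_cases h0 : ovl U V i j = 0
    · simp [h0]
    · have := phiI_integral (hp i) (hq j)
        (fun h => (supp_of_dom hA hr hp hd i j h).resolve_left h0)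
      refine ⟨this.1.const_mul _, ?_⟩
      rw [intervalIntegral.integral_const_mul, this.2]
  rw [hfun]
  have hi : ∀ i, IntervalIntegrable (fun s => ∑ j, ovl U V i j * phiI (p i) (q j) s)
      MeasureTheory.volume 0 1 := by
    intro i
    have := IntervalIntegrable.sum (μ := MeasureTheory.volume) (a := 0) (b := 1) Finset.univ
      (f := fun j s => ovl U V i j * phiI (p i) (q j) s) (fun j _ => (hterm i j).1)
    have e : ∀ g h : ℝ → ℝ, g = h → IntervalIntegrable h MeasureTheory.volume 0 1 →
        IntervalIntegrable g MeasureTheory.volume 0 1 := fun g h hgh hh => hgh ▸ hh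
    exact e _ _ (by ext s; simp) this
  constructor
  · have := IntervalIntegrable.sum (μ := MeasureTheory.volume) (a := 0) (b := 1) Finset.univ
      (f := fun i s => ∑ j, ovl U V i j * phiI (p i) (q j) s) (fun i _ => hi i)
    have e : ∀ g h : ℝ → ℝ, g = h → IntervalIntegrable h MeasureTheory.volume 0 1 →
        IntervalIntegrable g MeasureTheory.volume 0 1 := fun g h hgh hh => hgh ▸ hh
    exact e _ _ (by ext s; simp) this
  · rw [intervalIntegral.integral_finsetSum (fun i _ => hi i)]
    have : ∀ i, ∫ s in (0:ℝ)..1, ∑ j, ovl U V i j * phiI (p i) (q j) s =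
        ∑ j, ovl U V i j * (p i * Real.log (p i) - p i * Real.log (q j) - p i + q j) := by
      intro i
      rw [intervalIntegral.integral_finsetSum (fun j _ => (hterm i j).1)]
      exact Finset.sum_congr rfl fun j _ => (hterm i j).2
    simp only [this]
    rw [hA.crossE_eq, hA.entropy_ovl hr.right, hA.trace_ovl hr.right, hr.trace_ovl' hA.right]
    simp only [mul_sub, mul_add, Finset.sum_sub_distrib, Finset.sum_add_distrib]
    ring

/-- Monotonicity of the relative entropy under the dual of a *-homomorphism. -/
theorem relEnt_mono {m : Type*} [Fintype m] [DecidableEq m] {A B : Matrix n n ℂ}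
    {A' B' : Matrix m m ℂ} {V : Matrix n n ℂ} {q : n → ℝ} {V' : Matrix m m ℂ} {q' : m → ℝ}
    (hA : A.PosSemidef) (hB : B.PosSemidef) (hA' : A'.PosSemidef) (hB' : B'.PosSemidef)
    (hr : SpecRep B V q) (hr' : SpecRep B' V' q')
    {k k' : ℝ} (hd : ((k : ℂ) • B - A).PosSemidef) (hd' : ((k' : ℂ) • B' - A').PosSemidef)
    (Φ : Matrix m m ℂ → Matrix n n ℂ) (hmul : ∀ X Y, Φ (X * Y) = Φ X * Φ Y)
    (hstar : ∀ X, Φ Xᴴ = (Φ X)ᴴ)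
    (hΦA : ∀ Y, (A * Φ Y).trace = (A' * Y).trace) (hΦB : ∀ Y, (B * Φ Y).trace = (B' * Y).trace)
    (htA : A.trace = A'.trace) (htB : B.trace = B'.trace) :
    crossE A' V' q' - vnEntropy A' ≤ crossE A V q - vnEntropy A := by
  have rA := rep_exists hA.1
  have rA' := rep_exists hA'.1
  obtain ⟨i1, e1⟩ := relEnt_eq_integral rA hr (rA.nonneg hA) (hr.nonneg hB) hd
  obtain ⟨i2, e2⟩ := relEnt_eq_integral rA' hr' (rA'.nonneg hA') (hr'.nonneg hB') hd'
  rw [e1, e2, htA, htB]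
  have := intervalIntegral.integral_mono_on_of_le_Ioo zero_le_one i2 i1 (fun s hs => by
    refine mul_le_mul_of_nonneg_left ?_ (by linarith [hs.2])
    obtain ⟨Y, hY⟩ := varF_attained rA' hr' s
    rw [← hY]
    refine le_trans (le_of_eq ?_) (varF_le rA hr (rA.nonneg hA) (hr.nonneg hB) (Φ Y) hs.1 hs.2)
    rw [varF, varF, hΦA, hΦB, ← hstar, ← hmul, ← hmul, hΦA, hΦB])
  linarith

end DPI

section Marginals

open scoped Kronecker

variable {x e : Type*} [Fintype x] [DecidableEq x] [Fintype e] [DecidableEq e]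

/-- partial trace over the left factor -/
def ptrL (A : Matrix (x × e) (x × e) ℂ) : Matrix e e ℂ := fun u v => ∑ X : x, A (X, u) (X, v)

theorem ptrL_posSemidef {A : Matrix (x × e) (x × e) ℂ} (hA : A.PosSemidef) : (ptrL A).PosSemidef := by
  have : ptrL A = ∑ X : x, A.submatrix (fun u => (X, u)) (fun u => (X, u)) := by
    ext u v; simp [ptrL, Matrix.sum_apply]
  rw [this]
  exact posSemidef_sum _ fun X _ => hA.submatrix _

theorem ptrL_trace (A : Matrix (x × e) (x × e) ℂ) : (ptrL A).trace = A.trace := by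
  simp only [Matrix.trace, Matrix.diag_apply, ptrL, Fintype.sum_prod_type]
  rw [Finset.sum_comm]

theorem ptrL_add (A B : Matrix (x × e) (x × e) ℂ) : ptrL (A + B) = ptrL A + ptrL B := by
  ext u v; simp [ptrL, Finset.sum_add_distrib]

theorem psd_scale {m : Type*} [Fintype m] [DecidableEq m] {A : Matrix m m ℂ} (hA : A.PosSemidef)
    (t : m → ℝ) : (Matrix.of fun u v => ((t u * t v : ℝ) : ℂ) * A u v).PosSemidef := by
  have h := hA.mul_mul_conjTranspose_same (diagonal fun u => (t u : ℂ))
  convert h using 1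
  ext u v
  rw [diagonal_conjTranspose, Matrix.mul_diagonal, Matrix.diagonal_mul]
  simp
  ring

theorem delta_sum (a b : x) : ∑ y : x, ∑ y' : x,
    (((if a = y then (1:ℝ) else 0) - (if a = y' then (1:ℝ) else 0)) *
          ((if b = y then (1:ℝ) else 0) - (if b = y' then (1:ℝ) else 0)))
      = 2 * (if a = b then (Fintype.card x : ℝ) else 0) - 2 := by
  simp only [sub_mul, mul_sub, Finset.sum_sub_distrib, Finset.sum_const, Finset.card_univ,
      ← Finset.mul_sum, ← Finset.sum_mul]
  by_cases hab : a = b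
  · simp [hab]; ring
  · simp [hab, Ne.symm hab]; ring

theorem dom_ptrL {A : Matrix (x × e) (x × e) ℂ} (hA : A.PosSemidef) :
    ((((Fintype.card x : ℝ)) : ℂ) • ((1 : Matrix x x ℂ) ⊗ₖ ptrL A) - A).PosSemidef := by
  have h1 : (∑ y : x, ∑ y' : x, if y = y' then (0 : Matrix (x × e) (x × e) ℂ) else
      (((Fintype.card x : ℝ)) : ℂ) • (Matrix.of fun u v : x × e =>
        (((if u.1 = y then (1:ℝ) else 0) * (if v.1 = y then (1:ℝ) else 0) : ℝ) : ℂ) *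
          (A.submatrix (fun w : x × e => (y', w.2)) (fun w : x × e => (y', w.2))) u v)).PosSemidef := by
    refine posSemidef_sum _ fun y _ => posSemidef_sum _ fun y' _ => ?_
    split_ifs
    · exact PosSemidef.zero
    · refine PosSemidef.smul (psd_scale (hA.submatrix _) (fun u : x × e => if u.1 = y then (1:ℝ) else 0)) ?_
      exact_mod_cast Nat.cast_nonneg (α := ℝ) (Fintype.card x)
  have h2 : (((1/2 : ℝ) : ℂ) • ∑ y : x, ∑ y' : x, (Matrix.of fun u v =>
        ((((if u.1 = y then (1:ℝ) else 0) - (if u.1 = y' then (1:ℝ) else 0)) *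
          ((if v.1 = y then (1:ℝ) else 0) - (if v.1 = y' then (1:ℝ) else 0)) : ℝ) : ℂ) *
          A u v)).PosSemidef := by
    refine PosSemidef.smul (posSemidef_sum _ fun y _ => posSemidef_sum _ fun y' _ => ?_) ?_
    · exact psd_scale hA (fun u => (if u.1 = y then (1:ℝ) else 0) - (if u.1 = y' then (1:ℝ) else 0))
    · exact_mod_cast (by norm_num : (0:ℝ) ≤ 1/2)
  convert h1.add h2 using 1
  ext ⟨a, u⟩ ⟨b, v⟩
  simp only [Matrix.add_apply, Matrix.sub_apply, Matrix.smul_apply, Matrix.sum_apply,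
    Matrix.kroneckerMap_apply, smul_eq_mul, Matrix.of_apply, ptrL]
  have e2 : ∑ y : x, ∑ y' : x, ((((if a = y then (1:ℝ) else 0) - (if a = y' then (1:ℝ) else 0)) *
          ((if b = y then (1:ℝ) else 0) - (if b = y' then (1:ℝ) else 0)) : ℝ) : ℂ) * A (a, u) (b, v)
      = (2 * (if a = b then ((Fintype.card x : ℝ) : ℂ) else 0) - 2) * A (a, u) (b, v) := by
    simp only [← Finset.sum_mul, ← Complex.ofReal_sum, delta_sum]
    by_cases hab : a = b
    · simp [hab]
    · simp [hab]
  rw [e2]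
  have e1 : ∑ y : x, ∑ y' : x, (if y = y' then (0 : Matrix (x × e) (x × e) ℂ) else
      (((Fintype.card x : ℝ)) : ℂ) • (Matrix.of fun u v : x × e =>
        (((if u.1 = y then (1:ℝ) else 0) * (if v.1 = y then (1:ℝ) else 0) : ℝ) : ℂ) *
          (A.submatrix (fun w : x × e => (y', w.2)) (fun w : x × e => (y', w.2))) u v)) (a, u) (b, v)
      = if a = b then ((Fintype.card x : ℝ) : ℂ) *
          ((∑ y', A (y', u) (y', v)) - A (a, u) (a, v)) else 0 := by
    rw [Finset.sum_eq_single a]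
    · by_cases hab : a = b
      · subst hab
        rw [if_pos rfl, eq_comm, ← Finset.sum_erase_eq_sub (Finset.mem_univ a), Finset.mul_sum]
        refine Eq.trans ?_ (Finset.sum_erase (Finset.univ : Finset x) (a := a) (by simp))
        refine Finset.sum_congr rfl fun y' hy' => ?_
        rw [if_neg (Finset.ne_of_mem_erase hy').symm]
        simp
      · rw [if_neg hab]
        refine Finset.sum_eq_zero fun y' _ => ?_
        split_ifs
        · simp
        · simp [Ne.symm hab]
    · intro y _ hy
      refine Finset.sum_eq_zero fun y' _ => ?_
      split_ifs
      · simp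
      · simp [Ne.symm hy]
    · simp
  rw [e1]
  by_cases hab : a = b
  · subst hab; simp; ring
  · simp [hab]

theorem rep_kron {M V : Matrix e e ℂ} {q : e → ℝ} (h : SpecRep M V q) :
    SpecRep ((1 : Matrix x x ℂ) ⊗ₖ M) ((1 : Matrix x x ℂ) ⊗ₖ V) (fun u => q u.2) := by
  refine ⟨?_, ?_, ?_⟩
  · rw [conjTranspose_kronecker, ← mul_kronecker_mul, h.left]; simp
  · rw [conjTranspose_kronecker, ← mul_kronecker_mul, h.right]; simp
  · have : (diagonal (fun u : x × e => ((q u.2 : ℝ) : ℂ))) =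
        (1 : Matrix x x ℂ) ⊗ₖ diagonal (fun j => (q j : ℂ)) := by
      rw [← diagonal_one, diagonal_kronecker_diagonal]; simp
    rw [this, conjTranspose_kronecker, ← mul_kronecker_mul, ← mul_kronecker_mul, ← h.eq]; simp

theorem crossE_kron (A : Matrix (x × e) (x × e) ℂ) (V : Matrix e e ℂ) (q : e → ℝ) :
    crossE A ((1 : Matrix x x ℂ) ⊗ₖ V) (fun u => q u.2) = crossE (ptrL A) V q := by
  have key : ∀ X j, ((((1 : Matrix x x ℂ) ⊗ₖ V)ᴴ * A * ((1 : Matrix x x ℂ) ⊗ₖ V)) (X, j) (X, j)) =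
      ∑ c, ∑ c', star (V c' j) * A (X, c') (X, c) * V c j := by
    intro X j
    simp only [Matrix.mul_apply, Fintype.sum_prod_type, conjTranspose_apply, kroneckerMap_apply,
      one_apply, ite_mul, one_mul, zero_mul, mul_ite, mul_zero, apply_ite star, star_zero,
      Finset.sum_mul]
    rw [Finset.sum_eq_single X]
    · refine Finset.sum_congr rfl fun c _ => ?_
      rw [if_pos rfl, Finset.sum_eq_single X]
      · simp
      · intro y _ hy; simp [hy]
      · simp
    · intro y _ hy; simp [hy]
    · simp
  have key2 : ∀ j, (Vᴴ * ptrL A * V) j j = ∑ X, ∑ c, ∑ c', star (V c' j) * A (X, c') (X, c) * V c j := by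
    intro j
    simp only [Matrix.mul_apply, conjTranspose_apply, ptrL, Finset.mul_sum, Finset.sum_mul]
    rw [Finset.sum_comm]
    rw [Finset.sum_comm (s := (Finset.univ : Finset x))]
    rw [Finset.sum_comm]
    refine Finset.sum_congr rfl fun c _ => ?_
    rw [Finset.sum_comm]
  rw [crossE, crossE, Fintype.sum_prod_type, Finset.sum_comm]
  congr 1
  refine Finset.sum_congr rfl fun j _ => ?_
  rw [key2, Complex.re_sum, Finset.sum_mul]
  refine Finset.sum_congr rfl fun X _ => ?_
  rw [key]

theorem entropy_sub_le [Nonempty x] {A : Matrix (x × e) (x × e) ℂ} (hA : A.PosSemidef) :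
    vnEntropy (ptrL A) - vnEntropy A ≤ A.trace.re * Real.log (Fintype.card x) := by
  have hr := rep_exists (ptrL_posSemidef hA).1
  have h := crossE_le hA (PosSemidef.one.kronecker (ptrL_posSemidef hA)) (rep_kron (x := x) hr)
    (by exact_mod_cast Fintype.card_pos) (dom_ptrL hA)
  rw [crossE_kron, crossE_self hr] at h
  linarith

theorem entropy_le_sub [Nonempty x] {A : Matrix (x × e) (x × e) ℂ} (hA : A.PosSemidef) :
    vnEntropy A - vnEntropy (ptrL A) ≤ A.trace.re * Real.log (Fintype.card x) := by
  have hr := rep_exists (ptrL_posSemidef hA).1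
  have hc : (0:ℝ) < Fintype.card x := by exact_mod_cast Fintype.card_pos
  have h := klein hA (PosSemidef.one.kronecker (ptrL_posSemidef hA)) (rep_kron (x := x) hr)
    (dom_ptrL hA) (inv_pos.2 hc)
  rw [crossE_kron, crossE_self hr, Matrix.trace_kronecker, ptrL_trace, Matrix.trace_one,
    Real.log_inv, Complex.mul_re] at h
  simp only [Complex.natCast_re, Complex.natCast_im, zero_mul, sub_zero] at h
  rw [inv_mul_cancel_left₀ hc.ne'] at h
  linarith

theorem gap_le {A B : Matrix e e ℂ} (hA : A.PosSemidef) (hB : B.PosSemidef) :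
    vnEntropy (A + B) ≤ vnEntropy A + vnEntropy B := by
  have hr := rep_exists (hA.add hB).1
  have h1 := crossE_le (k := 1) hA (hA.add hB) hr one_pos (by simpa using hB)
  have h2 := crossE_le (k := 1) hB (hA.add hB) hr one_pos (by simpa using hA)
  rw [← crossE_self hr, crossE_add]
  simp at h1 h2
  linarith

theorem gap_ge {A B : Matrix e e ℂ} (hA : A.PosSemidef) (hB : B.PosSemidef) {s t : ℝ}
    (hs : 0 < s) (ht : 0 < t) (hAs : A.trace.re = s) (hBt : B.trace.re = t) :
    vnEntropy A + vnEntropy B + s * Real.log s + t * Real.log t - (s + t) * Real.log (s + t) ≤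
      vnEntropy (A + B) := by
  have hr := rep_exists (hA.add hB).1
  have hst : 0 < s + t := by linarith
  have h1 := klein (k := 1) hA (hA.add hB) hr (by simpa using hB) (div_pos hs hst)
  have h2 := klein (k := 1) hB (hA.add hB) hr (by simpa using hA) (div_pos ht hst)
  rw [← crossE_self hr, crossE_add]
  rw [Matrix.trace_add, Complex.add_re, hAs, hBt, div_mul_cancel₀ _ hst.ne', Real.log_div hs.ne' hst.ne'] at h1
  rw [Matrix.trace_add, Complex.add_re, hAs, hBt, div_mul_cancel₀ _ hst.ne', Real.log_div ht.ne' hst.ne'] at h2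
  nlinarith

end Marginals

section OneCopy

open scoped Kronecker

variable {x γ δ : Type*} [Fintype x] [DecidableEq x] [Fintype γ] [DecidableEq γ]
  [Fintype δ] [DecidableEq δ]

theorem mCD_eq (ρ : Matrix (x × γ × δ) (x × γ × δ) ℂ) : mCD ρ = ptrL ρ := rfl

theorem mC_eq (ρ : Matrix (x × γ × δ) (x × γ × δ) ℂ) : mC ρ = ptrL (mXC ρ) := rfl

theorem mXC_posSemidef {A : Matrix (x × γ × δ) (x × γ × δ) ℂ} (hA : A.PosSemidef) :
    (mXC A).PosSemidef := by
  have : mXC A = ∑ w : δ, A.submatrix (fun u : x × γ => (u.1, u.2, w)) (fun u => (u.1, u.2, w)) := by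
    ext u v; simp [mXC, Matrix.sum_apply]
  rw [this]
  exact posSemidef_sum _ fun X _ => hA.submatrix _

theorem mXC_trace (A : Matrix (x × γ × δ) (x × γ × δ) ℂ) : (mXC A).trace = A.trace := by
  simp only [Matrix.trace, Matrix.diag_apply, mXC, Fintype.sum_prod_type]

theorem mXC_add (A B : Matrix (x × γ × δ) (x × γ × δ) ℂ) : mXC (A + B) = mXC A + mXC B := by
  ext u v; simp [mXC, Finset.sum_add_distrib]

theorem mC_add (A B : Matrix (x × γ × δ) (x × γ × δ) ℂ) : mC (A + B) = mC A + mC B := by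
  rw [mC_eq, mXC_add, ptrL_add]; rfl

/-- embedding `Y ↦ Y ⊗ 1_D`. -/
def embXC (Y : Matrix (x × γ) (x × γ) ℂ) : Matrix (x × γ × δ) (x × γ × δ) ℂ :=
  (Y ⊗ₖ (1 : Matrix δ δ ℂ)).submatrix (Equiv.prodAssoc x γ δ).symm (Equiv.prodAssoc x γ δ).symm

theorem embXC_mul (X Y : Matrix (x × γ) (x × γ) ℂ) :
    (embXC (X * Y) : Matrix (x × γ × δ) (x × γ × δ) ℂ) = embXC X * embXC Y := by
  rw [embXC, embXC, embXC, submatrix_mul_equiv, ← mul_kronecker_mul, Matrix.one_mul]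

theorem embXC_star (X : Matrix (x × γ) (x × γ) ℂ) :
    (embXC Xᴴ : Matrix (x × γ × δ) (x × γ × δ) ℂ) = (embXC X)ᴴ := by
  rw [embXC, embXC, conjTranspose_submatrix, conjTranspose_kronecker, conjTranspose_one]

theorem embXC_trace (A : Matrix (x × γ × δ) (x × γ × δ) ℂ) (Y : Matrix (x × γ) (x × γ) ℂ) :
    (A * embXC Y).trace = (mXC A * Y).trace := by
  simp only [Matrix.trace, Matrix.diag_apply, Matrix.mul_apply, embXC, submatrix_apply,
    kroneckerMap_apply, mXC, Fintype.sum_prod_type, Equiv.prodAssoc_symm_apply, one_apply,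
    mul_ite, mul_one, mul_zero, Finset.sum_ite_eq', Finset.mem_univ, if_true, Finset.sum_mul]
  refine Finset.sum_congr rfl fun X _ => Finset.sum_congr rfl fun c _ => ?_
  rw [Finset.sum_comm]
  refine Finset.sum_congr rfl fun X' _ => ?_
  rw [Finset.sum_comm]

theorem mXC_kron (M : Matrix (x × γ × δ) (x × γ × δ) ℂ) :
    mXC ((1 : Matrix x x ℂ) ⊗ₖ mCD M) = (1 : Matrix x x ℂ) ⊗ₖ mC M := by
  ext u v
  change ∑ w : δ, (1 : Matrix x x ℂ) u.1 v.1 * ∑ X, M (X, u.2, w) (X, v.2, w) =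
    (1 : Matrix x x ℂ) u.1 v.1 * ∑ X, ∑ w, M (X, u.2, w) (X, v.2, w)
  rw [← Finset.mul_sum, Finset.sum_comm]

/-- strong subadditivity -/
theorem qcmi_nonneg {M : Matrix (x × γ × δ) (x × γ × δ) ℂ} (hM : M.PosSemidef) :
    0 ≤ qcmiXD_C M := by
  have h1 := rep_exists (ptrL_posSemidef hM).1
  have h2 := rep_exists (ptrL_posSemidef (mXC_posSemidef hM)).1
  have h := relEnt_mono hM (PosSemidef.one.kronecker (ptrL_posSemidef hM)) (mXC_posSemidef hM)
    (PosSemidef.one.kronecker (ptrL_posSemidef (mXC_posSemidef hM)))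
    (rep_kron (x := x) h1) (rep_kron (x := x) h2) (dom_ptrL hM) (dom_ptrL (mXC_posSemidef hM))
    embXC embXC_mul embXC_star (embXC_trace M)
    (fun Y => by
      have := mXC_kron M
      rw [mCD_eq, mC_eq] at this
      rw [← this, embXC_trace]) (mXC_trace M).symm
    (by rw [Matrix.trace_kronecker, Matrix.trace_kronecker, ptrL_trace, ptrL_trace, mXC_trace])
  rw [crossE_kron, crossE_kron, crossE_self h1, crossE_self h2] at h
  rw [qcmiXD_C, mCD_eq, mC_eq]
  linarith

theorem gap_mono {A B : Matrix (x × γ × δ) (x × γ × δ) ℂ} (hA : A.PosSemidef) (hB : B.PosSemidef) :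
    vnEntropy (mXC (A + B)) - vnEntropy (mXC A) - vnEntropy (mXC B) ≤
      vnEntropy (A + B) - vnEntropy A - vnEntropy B := by
  have hAB := hA.add hB
  have h1 := rep_exists hAB.1
  have h2 := rep_exists (mXC_posSemidef hAB).1
  have hA' := mXC_posSemidef hA
  have hB' := mXC_posSemidef hB
  have ha := relEnt_mono (k := 1) (k' := 1) hA hAB hA' (mXC_posSemidef hAB) h1 h2 (by simpa using hB)
    (by rw [mXC_add]; simpa using hB')
    embXC embXC_mul embXC_star (embXC_trace _) (embXC_trace _) (mXC_trace _).symm (mXC_trace _).symm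
  have hb := relEnt_mono (k := 1) (k' := 1) hB hAB hB' (mXC_posSemidef hAB) h1 h2 (by simpa using hA)
    (by rw [mXC_add]; simpa using hA')
    embXC embXC_mul embXC_star (embXC_trace _) (embXC_trace _) (mXC_trace _).symm (mXC_trace _).symm
  have e1 := crossE_self h1
  have e2 := crossE_self h2
  have f1 := crossE_add A B (hAB.1.eigenvectorUnitary : Matrix _ _ ℂ) hAB.1.eigenvalues
  have f2 := crossE_add (mXC A) (mXC B) ((mXC_posSemidef hAB).1.eigenvectorUnitary : Matrix _ _ ℂ)
    (mXC_posSemidef hAB).1.eigenvalues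
  rw [← mXC_add] at f2
  linarith

theorem qcmi_le [Nonempty x] {M : Matrix (x × γ × δ) (x × γ × δ) ℂ} (hM : M.PosSemidef) :
    qcmiXD_C M ≤ 2 * M.trace.re * Real.log (Fintype.card x) := by
  have h1 := entropy_sub_le hM
  have h2 := entropy_le_sub (mXC_posSemidef hM)
  rw [mXC_trace] at h2
  rw [qcmiXD_C, mCD_eq, mC_eq]
  linarith

theorem one_copy_aux [Nonempty x] {ρ σ N P : Matrix (x × γ × δ) (x × γ × δ) ℂ}
    (hρ : ρ.PosSemidef) (hσ : σ.PosSemidef) (hN : N.PosSemidef) (hP : P.PosSemidef)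
    (hρ1 : ρ.trace = 1) (hm : mCD ρ = mCD σ) (hadd : ρ + N = σ + P) {t : ℝ} (ht : 0 < t)
    (hNt : N.trace.re = t) (hPt : P.trace.re = t) :
    qcmiXD_C ρ - qcmiXD_C σ ≤ 2 * t * Real.log (Fintype.card x) + gFun t := by
  have hmN : mCD N = mCD P := by
    have := congrArg mCD hadd
    rw [mCD_eq, mCD_eq, ptrL_add, ptrL_add] at this
    rw [mCD_eq, mCD_eq] at hm ⊢
    rw [hm] at this
    exact add_left_cancel this
  have hmC : ∀ A : Matrix (x × γ × δ) (x × γ × δ) ℂ,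
      mC A = fun i j => ∑ w : δ, mCD A (i, w) (j, w) := by
    intro A; ext i j; simp only [mC, mCD]; rw [Finset.sum_comm]
  have hcC : mC ρ = mC σ := by rw [hmC, hmC, hm]
  have hcN : mC N = mC P := by rw [hmC, hmC, hmN]
  have g1 := gap_mono hσ hP
  have g2 := gap_le hρ hN
  have g3 := gap_ge (mXC_posSemidef hρ) (mXC_posSemidef hN) one_pos ht
    (by rw [mXC_trace, hρ1]; simp) (by rw [mXC_trace, hNt])
  have g4 := qcmi_nonneg hN
  have g5 := qcmi_le hP
  rw [hPt] at g5
  rw [← mXC_add, hadd] at g3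
  rw [hadd] at g2
  simp only [Real.log_one, mul_zero, add_zero] at g3
  simp only [qcmiXD_C, hm, hcC, hmN, hcN, gFun] at *
  linarith

theorem gFun_mono {s t : ℝ} (hs : 0 ≤ s) (hst : s ≤ t) : gFun s ≤ gFun t := by
  have hm : MonotoneOn gFun (Set.Ici 0) := by
    have hc : Continuous gFun := by
      have : gFun = fun y => (1 + y) * Real.log (1 + y) - y * Real.log y := rfl
      rw [this]
      exact (Real.continuous_mul_log.comp (continuous_const.add continuous_id)).sub
        Real.continuous_mul_log
    have hd : ∀ y ∈ interior (Set.Ici (0:ℝ)),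
        HasDerivAt gFun (Real.log (1 + y) - Real.log y) y := by
      intro y hy
      rw [interior_Ici] at hy
      have hy' : (0:ℝ) < y := hy
      have h1 := (Real.hasDerivAt_mul_log (x := 1 + y) (by positivity)).comp y
        ((hasDerivAt_id y).const_add 1)
      have h2 := Real.hasDerivAt_mul_log (x := y) hy'.ne'
      have := h1.sub h2
      convert! this using 1
      ring
    refine monotoneOn_of_deriv_nonneg (convex_Ici 0) hc.continuousOn
      (fun y hy => (hd y hy).differentiableAt.differentiableWithinAt) (fun y hy => ?_)
    rw [(hd y hy).deriv]
    rw [interior_Ici] at hy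
    have hy' : (0:ℝ) < y := hy
    have := Real.log_le_log hy' (by linarith : y ≤ 1 + y)
    linarith
  exact hm hs (hs.trans hst) hst

theorem one_copy_half [Nonempty x] {ρ σ : Matrix (x × γ × δ) (x × γ × δ) ℂ}
    (hρ : ρ.PosSemidef) (hσ : σ.PosSemidef)
    (hρ1 : ρ.trace = 1) (hσ1 : σ.trace = 1) (hm : mCD ρ = mCD σ) {ε : ℝ} (hε : 0 ≤ ε)
    (hn : traceNorm (ρ - σ) ≤ 2 * ε) :
    qcmiXD_C ρ - qcmiXD_C σ ≤ 2 * ε * Real.log (Fintype.card x) + gFun ε := by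
  have hr := rep_exists (hρ.1.sub hσ.1)
  set U := ((hρ.1.sub hσ.1).eigenvectorUnitary : Matrix (x × γ × δ) (x × γ × δ) ℂ)
  set d := (hρ.1.sub hσ.1).eigenvalues
  rw [hr.traceNorm_eq] at hn
  have htr := hr.trace
  rw [Matrix.trace_sub, hρ1, hσ1] at htr
  simp only [sub_self, Complex.zero_re] at htr
  have rP : SpecRep (U * diagonal (fun i => ((max (d i) 0 : ℝ) : ℂ)) * Uᴴ) U (fun i => max (d i) 0) :=
    ⟨hr.left, hr.right, rfl⟩
  have rN : SpecRep (U * diagonal (fun i => ((max (-d i) 0 : ℝ) : ℂ)) * Uᴴ) U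
    (fun i => max (-d i) 0) := ⟨hr.left, hr.right, rfl⟩
  set P := U * diagonal (fun i => ((max (d i) 0 : ℝ) : ℂ)) * Uᴴ
  set N := U * diagonal (fun i => ((max (-d i) 0 : ℝ) : ℂ)) * Uᴴ
  have hP := rP.posSemidef (fun i => le_max_right _ _)
  have hN := rN.posSemidef (fun i => le_max_right _ _)
  have hsub : P - N = ρ - σ := by
    rw [hr.eq, ← Matrix.sub_mul, ← Matrix.mul_sub, diagonal_sub]
    congr 3
    ext i
    rw [← Complex.ofReal_sub]
    congr 1
    rcases le_total (d i) 0 with h | h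
    · rw [max_eq_right h, max_eq_left (by linarith)]; ring
    · rw [max_eq_left h, max_eq_right (by linarith)]; ring
  have hadd : ρ + N = σ + P := by
    have : ρ + N - (σ + P) = (ρ - σ) - (P - N) := by abel
    rw [hsub, sub_self] at this
    exact sub_eq_zero.1 this
  have hPN : P.trace.re = N.trace.re := by
    have := congrArg Matrix.trace hadd
    rw [Matrix.trace_add, Matrix.trace_add, hρ1, hσ1] at this
    rw [add_left_cancel this]
  have hPN2 : P.trace.re + N.trace.re = ∑ i, |d i| := by
    rw [rP.trace, rN.trace, ← Finset.sum_add_distrib]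
    refine Finset.sum_congr rfl fun i _ => ?_
    rcases le_total (d i) 0 with h | h
    · rw [max_eq_right h, max_eq_left (by linarith), abs_of_nonpos h]; ring
    · rw [max_eq_left h, max_eq_right (by linarith), abs_of_nonneg h]; ring
  have ht : P.trace.re ≤ ε := by linarith
  have hlog : 0 ≤ Real.log (Fintype.card x) :=
    Real.log_nonneg (by exact_mod_cast Fintype.card_pos)
  have ht0 : 0 ≤ P.trace.re := by
    rw [rP.trace]; exact Finset.sum_nonneg fun i _ => le_max_right _ _
  have hg := gFun_mono ht0 ht
  rcases ht0.eq_or_lt with h0 | h0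
  · have hz : ∀ i, d i = 0 := by
      have : ∑ i, |d i| = 0 := by linarith
      rw [Finset.sum_eq_zero_iff_of_nonneg (fun i _ => abs_nonneg _)] at this
      intro i; exact abs_eq_zero.1 (this i (Finset.mem_univ i))
    have : ρ - σ = 0 := by
      rw [hr.eq]; simp [hz]
    rw [sub_eq_zero.1 this, sub_self]
    have : gFun 0 = 0 := by simp [gFun]
    rw [← h0, this] at hg
    positivity
  · have := one_copy_aux hρ hσ hN hP hρ1 hm hadd h0 hPN.symm rfl
    have h3 : P.trace.re * Real.log (Fintype.card x) ≤ ε * Real.log (Fintype.card x) :=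
      mul_le_mul_of_nonneg_right ht hlog
    linarith

theorem SpecRep.neg {n : Type*} [Fintype n] [DecidableEq n] {A U : Matrix n n ℂ} {p : n → ℝ}
    (h : SpecRep A U p) : SpecRep (-A) U (fun i => - p i) :=
  ⟨h.left, h.right, by
    have : (diagonal fun i => ((- p i : ℝ) : ℂ)) = - diagonal fun i => ((p i : ℝ) : ℂ) := by
      rw [diagonal_neg]; congr 1; ext i; simp
    rw [this, Matrix.mul_neg, Matrix.neg_mul, ← h.eq]⟩

theorem one_copy [Nonempty x] {ρ σ : Matrix (x × γ × δ) (x × γ × δ) ℂ}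
    (hρ : ρ.PosSemidef) (hσ : σ.PosSemidef)
    (hρ1 : ρ.trace = 1) (hσ1 : σ.trace = 1) (hm : mCD ρ = mCD σ) {ε : ℝ} (hε : 0 ≤ ε)
    (hn : traceNorm (ρ - σ) ≤ 2 * ε) :
    |qcmiXD_C ρ - qcmiXD_C σ| ≤ 2 * ε * Real.log (Fintype.card x) + gFun ε := by
  have hn' : traceNorm (σ - ρ) ≤ 2 * ε := by
    have hr := rep_exists (hρ.1.sub hσ.1)
    have hr' := hr.neg
    rw [neg_sub] at hr'
    rw [hr'.traceNorm_eq]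
    rw [hr.traceNorm_eq] at hn
    simpa using hn
  rw [abs_le]
  have h1 := one_copy_half hρ hσ hρ1 hσ1 hm hε hn
  have h2 := one_copy_half hσ hρ hσ1 hρ1 hm.symm hε hn'
  constructor <;> linarith

end OneCopy

section Tele

theorem psd_factor {n : Type*} [Fintype n] [DecidableEq n] {A : Matrix n n ℂ}
    (hA : A.PosSemidef) : ∃ B : Matrix n n ℂ, A = Bᴴ * B := by
  have h := rep_exists hA.1
  refine ⟨diagonal (fun i => ((Real.sqrt (hA.1.eigenvalues i) : ℝ) : ℂ)) *
    (hA.1.eigenvectorUnitary : Matrix n n ℂ)ᴴ, ?_⟩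
  rw [conjTranspose_mul, conjTranspose_conjTranspose, diagonal_conjTranspose, Matrix.mul_assoc,
    ← Matrix.mul_assoc (diagonal _) (diagonal _), diagonal_mul_diagonal, ← Matrix.mul_assoc]
  refine h.eq.trans ?_
  congr 3
  ext i
  have := Real.mul_self_sqrt (hA.eigenvalues_nonneg i)
  simp only [Pi.star_apply, Complex.star_def, Complex.conj_ofReal]
  rw [← Complex.ofReal_mul, this]

theorem IsChannel.kraus {a b : Type*} [Fintype a] [DecidableEq a] [Fintype b] [DecidableEq b]
    {T : b → b → a → a → ℂ} (hT : IsChannel T) :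
    ∃ K : (b × Fin (Fintype.card a)) → b → a → ℂ,
      ∀ i j k l, T i j k l = ∑ μ, K μ i k * star (K μ j l) := by
  let e : Fin (Fintype.card a) ≃ a := (Fintype.equivFin a).symm
  let v : a × Fin (Fintype.card a) → ℂ := fun z => if z.1 = e z.2 then 1 else 0
  have h := hT.2 (Fin (Fintype.card a)) (vecMulVec v (star v)) (posSemidef_vecMulVec_self_star v)
  obtain ⟨B, hB⟩ := psd_factor h
  refine ⟨fun μ i k => star (B μ (i, e.symm k)), fun i j k l => ?_⟩
  have h2 := congrFun (congrFun hB (i, e.symm k)) (j, e.symm l)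
  rw [Matrix.mul_apply] at h2
  simp only [conjTranspose_apply, chApplyExt, vecMulVec_apply, v, Pi.star_apply,
    Equiv.apply_symm_apply, star_one, star_zero, apply_ite star, mul_ite, ite_mul, mul_one,
    one_mul, mul_zero, zero_mul, Finset.sum_ite_eq', Finset.sum_ite_eq, Finset.mem_univ, if_true] at h2
  simpa using h2

theorem IsChannel.tp {a b : Type*} [Fintype a] [DecidableEq a] [Fintype b] [DecidableEq b]
    {T : b → b → a → a → ℂ} (hT : IsChannel T) (k l : a) :
    ∑ i, T i i k l = if k = l then 1 else 0 := by
  have h := hT.1 (Matrix.of fun x y => if x = k then (if y = l then 1 else 0) else 0)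
  simpa [Matrix.trace, chApply, eq_comm] using h

variable {ι a b r : Type*} [Fintype ι] [DecidableEq ι] [Fintype a] [DecidableEq a]
  [Fintype b] [DecidableEq b] [Fintype r] [DecidableEq r]

/-- tensor product of a family of maps -/
def famApply (Ts : ι → b → b → a → a → ℂ)
    (ρ : Matrix ((ι → a) × r) ((ι → a) × r) ℂ) : Matrix ((ι → b) × r) ((ι → b) × r) ℂ :=
  fun X Y => ∑ K : ι → a, ∑ L : ι → a,
    (∏ m, Ts m (X.1 m) (Y.1 m) (K m) (L m)) * ρ (K, X.2) (L, Y.2)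

theorem famApply_posSemidef {Ts : ι → b → b → a → a → ℂ} (hT : ∀ m, IsChannel (Ts m))
    {ρ : Matrix ((ι → a) × r) ((ι → a) × r) ℂ} (hρ : ρ.PosSemidef) :
    (famApply Ts ρ).PosSemidef := by
  choose K hK using fun m => (hT m).kraus
  let G : (ι → (b × Fin (Fintype.card a))) → Matrix ((ι → b) × r) ((ι → a) × r) ℂ :=
    fun μ => Matrix.of fun X Z => if X.2 = Z.2 then ∏ m, K m (μ m) (X.1 m) (Z.1 m) else 0
  have : famApply Ts ρ = ∑ μ, G μ * ρ * (G μ)ᴴ := by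
    ext X Y
    rw [Matrix.sum_apply]
    have h1 : ∀ μ, (G μ * ρ * (G μ)ᴴ) X Y = ∑ M : ι → a, ∑ L : ι → a,
        (∏ m, K m (μ m) (X.1 m) (M m) * star (K m (μ m) (Y.1 m) (L m))) *
          ρ (M, X.2) (L, Y.2) := by
      intro μ
      simp only [Matrix.mul_apply, conjTranspose_apply, G, Matrix.of_apply, Fintype.sum_prod_type, ite_mul,
        zero_mul, Finset.sum_ite_eq, Finset.mem_univ, if_true, apply_ite star, star_zero,
        mul_ite, mul_zero]
      rw [Finset.sum_comm]
      simp only [Finset.sum_mul]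
      refine Finset.sum_congr rfl fun M _ => Finset.sum_congr rfl fun L _ => ?_
      rw [star_prod, Finset.prod_mul_distrib]
      ring
    simp only [h1]
    rw [Finset.sum_comm]
    refine Finset.sum_congr rfl fun M _ => ?_
    rw [Finset.sum_comm]
    refine Finset.sum_congr rfl fun L _ => ?_
    rw [← Finset.sum_mul]
    congr 1
    simp only [hK]
    rw [Finset.prod_univ_sum, Fintype.piFinset_univ]
  rw [this]
  exact Matrix.posSemidef_sum _ fun μ _ => hρ.mul_mul_conjTranspose_same _

theorem famApply_tp {Ts : ι → b → b → a → a → ℂ} (hT : ∀ m, IsChannel (Ts m))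
    (ρ : Matrix ((ι → a) × r) ((ι → a) × r) ℂ) (w w' : r) :
    ∑ X, famApply Ts ρ (X, w) (X, w') = ∑ K, ρ (K, w) (K, w') := by
  simp only [famApply]
  rw [Finset.sum_comm]
  refine Finset.sum_congr rfl fun K _ => ?_
  rw [Finset.sum_comm]
  have : ∀ L : ι → a, ∑ X : ι → b, (∏ m, Ts m (X m) (X m) (K m) (L m)) * ρ (K, w) (L, w') =
      if K = L then ρ (K, w) (L, w') else 0 := by
    intro L
    rw [← Finset.sum_mul]
    have h := Finset.prod_univ_sum (fun _ : ι => (Finset.univ : Finset b))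
      (fun m i => Ts m i i (K m) (L m))
    rw [Fintype.piFinset_univ] at h
    rw [← h]
    simp only [fun m => (hT m).tp]
    by_cases hKL : K = L
    · subst hKL; simp
    · rw [if_neg hKL]
      obtain ⟨m, hm⟩ := Function.ne_iff.1 hKL
      rw [Finset.prod_eq_zero (Finset.mem_univ m) (by rw [if_neg hm]), zero_mul]
  simp only [this, Finset.sum_ite_eq, Finset.mem_univ, if_true]

theorem famApply_trace {Ts : ι → b → b → a → a → ℂ} (hT : ∀ m, IsChannel (Ts m))
    (ρ : Matrix ((ι → a) × r) ((ι → a) × r) ℂ) : (famApply Ts ρ).trace = ρ.trace := by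
  simp only [Matrix.trace, Matrix.diag_apply, Fintype.sum_prod_type_right, famApply_tp hT]

/-- glue a value at `k` with the rest -/
abbrev glue {c : Type*} (k : ι) : c × ({j // j ≠ k} → c) ≃ (ι → c) := (Equiv.funSplitAt k c).symm

theorem glue_self {c : Type*} (k : ι) (i : c) (f : {j // j ≠ k} → c) : glue k (i, f) k = i := by
  simp [glue]

theorem glue_ne {c : Type*} (k : ι) (i : c) (f : {j // j ≠ k} → c) (m : {j // j ≠ k}) :
    glue k (i, f) m = f m := by
  simp [glue, m.2]

theorem glue_update {c : Type*} (k : ι) (i j : c) (f : {j // j ≠ k} → c) :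
    Function.update (glue k (i, f)) k j = glue k (j, f) := by
  ext m
  by_cases h : m = k
  · subst h; rw [Function.update_self, glue_self]
  · rw [Function.update_of_ne h]
    exact (glue_ne k i f ⟨m, h⟩).trans (glue_ne k j f ⟨m, h⟩).symm

/-- the input at site `k`, where the remaining sites have been processed -/
def restSt (k : ι) (Ts : ι → b → b → a → a → ℂ) (ρ : Matrix ((ι → a) × r) ((ι → a) × r) ℂ) :
    Matrix (a × (({j // j ≠ k} → b) × r)) (a × (({j // j ≠ k} → b) × r)) ℂ :=
  (famApply (fun j : {j // j ≠ k} => Ts j)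
    (ρ.submatrix (fun z : ({j // j ≠ k} → a) × (a × r) => (glue k (z.2.1, z.1), z.2.2))
      (fun z => (glue k (z.2.1, z.1), z.2.2)))).submatrix
    (fun z => (z.2.1, (z.1, z.2.2))) (fun z => (z.2.1, (z.1, z.2.2)))

theorem restSt_posSemidef (k : ι) {Ts : ι → b → b → a → a → ℂ} (hT : ∀ m, IsChannel (Ts m))
    {ρ : Matrix ((ι → a) × r) ((ι → a) × r) ℂ} (hρ : ρ.PosSemidef) :
    (restSt k Ts ρ).PosSemidef := by
  unfold restSt
  apply PosSemidef.submatrix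
  apply famApply_posSemidef
  · intro m; exact hT m
  · apply PosSemidef.submatrix
    exact hρ

theorem restSt_ptrace (k : ι) {Ts : ι → b → b → a → a → ℂ} (hT : ∀ m, IsChannel (Ts m))
    (ρ : Matrix ((ι → a) × r) ((ι → a) × r) ℂ) (i j : a) :
    ptraceRef (restSt k Ts ρ) i j = ∑ K, ∑ w, ρ (glue k (i, K), w) (glue k (j, K), w) := by
  simp only [ptraceRef, restSt, submatrix_apply, Fintype.sum_prod_type_right]
  rw [Finset.sum_comm (s := (Finset.univ : Finset ({j // j ≠ k} → a)))]
  refine Finset.sum_congr rfl fun w _ => ?_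
  rw [famApply_tp (fun m : {j // j ≠ k} => hT m)]
  rfl

theorem famApply_split (k : ι) (Ts : ι → b → b → a → a → ℂ)
    (ρ : Matrix ((ι → a) × r) ((ι → a) × r) ℂ) (i j : b) (f g : {j // j ≠ k} → b) (w w' : r) :
    famApply Ts ρ (glue k (i, f), w) (glue k (j, g), w') =
      chApplyExt (Ts k) (restSt k Ts ρ) (i, (f, w)) (j, (g, w')) := by
  simp only [famApply, chApplyExt, restSt, submatrix_apply]
  rw [← Equiv.sum_comp (glue k), Fintype.sum_prod_type]
  refine Finset.sum_congr rfl fun x _ => ?_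
  have : ∀ K : {j // j ≠ k} → a, ∑ L : ι → a,
      (∏ m, Ts m (glue k (i, f) m) (glue k (j, g) m) (glue k (x, K) m) (L m)) *
        ρ (glue k (x, K), w) (L, w') = ∑ y : a, ∑ L : {j // j ≠ k} → a,
        Ts k i j x y * ((∏ m : {j // j ≠ k}, Ts m (f m) (g m) (K m) (L m)) *
          ρ (glue k (x, K), w) (glue k (y, L), w')) := by
    intro K
    rw [← Equiv.sum_comp (glue k), Fintype.sum_prod_type]
    refine Finset.sum_congr rfl fun y _ => Finset.sum_congr rfl fun L _ => ?_
    rw [Fintype.prod_eq_mul_prod_subtype_ne _ k]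
    simp only [glue_self, glue_ne]
    ring
  simp only [this]
  rw [Finset.sum_comm]
  refine Finset.sum_congr rfl fun y _ => ?_
  simp only [Finset.mul_sum]

theorem chApplyExt_tp {T : b → b → a → a → ℂ} (hT : IsChannel T)
    (τ : Matrix (a × r) (a × r) ℂ) (w w' : r) :
    ∑ i, chApplyExt T τ (i, w) (i, w') = ∑ x, τ (x, w) (x, w') := by
  simp only [chApplyExt]
  rw [Finset.sum_comm]
  refine Finset.sum_congr rfl fun x _ => ?_
  rw [Finset.sum_comm]
  simp only [← Finset.sum_mul, hT.tp, ite_mul, one_mul, zero_mul, Finset.sum_ite_eq,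
    Finset.mem_univ, if_true]

end Tele

section Step
variable {ι a b γ δ : Type*} [Fintype ι] [DecidableEq ι] [Fintype a] [DecidableEq a]
  [Fintype b] [DecidableEq b] [Fintype γ] [DecidableEq γ] [Fintype δ] [DecidableEq δ]

/-- reindexing that singles out site `k` -/
def stepE (k : ι) : b × (({j // j ≠ k} → b) × γ) × δ ≃ (ι → b) × γ × δ where
  toFun z := (glue k (z.1, z.2.1.1), z.2.1.2, z.2.2)
  invFun z := (((glue k).symm z.1).1, (((glue k).symm z.1).2, z.2.1), z.2.2)
  left_inv z := by simp only [Equiv.symm_apply_apply]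
  right_inv z := by simp only [Prod.mk.eta, Equiv.apply_symm_apply]

def stepE2 (k : ι) : b × (({j // j ≠ k} → b) × γ) ≃ (ι → b) × γ where
  toFun z := (glue k (z.1, z.2.1), z.2.2)
  invFun z := (((glue k).symm z.1).1, (((glue k).symm z.1).2, z.2))
  left_inv z := by simp only [Equiv.symm_apply_apply]
  right_inv z := by simp only [Prod.mk.eta, Equiv.apply_symm_apply]

theorem step_mCD (k : ι) (P : Matrix ((ι → b) × γ × δ) ((ι → b) × γ × δ) ℂ) (u v : γ × δ) :
    mCD P u v = ∑ f : {j // j ≠ k} → b,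
      mCD (P.submatrix (stepE k) (stepE k)) ((f, u.1), u.2) ((f, v.1), v.2) := by
  simp only [mCD, submatrix_apply]
  rw [← Equiv.sum_comp (glue k), Fintype.sum_prod_type_right]
  rfl

theorem mC_of_mCD {x : Type*} [Fintype x] [DecidableEq x]
    (P : Matrix (x × γ × δ) (x × γ × δ) ℂ) (i j : γ) :
    mC P i j = ∑ w, mCD P (i, w) (j, w) := by
  simp only [mC, mCD]
  rw [Finset.sum_comm]

theorem step_chain (k : ι) (P P' : Matrix ((ι → b) × γ × δ) ((ι → b) × γ × δ) ℂ)
    (h : mCD (P.submatrix (stepE k) (stepE k)) = mCD (P'.submatrix (stepE k) (stepE k))) :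
    qcmiXD_C P - qcmiXD_C P' = qcmiXD_C (P.submatrix (stepE k) (stepE k)) -
      qcmiXD_C (P'.submatrix (stepE k) (stepE k)) := by
  have h1 : mCD P = mCD P' := by
    ext u v; rw [step_mCD k, step_mCD k, h]
  have h2 : mC P = mC P' := by
    ext u v; rw [mC_of_mCD, mC_of_mCD, h1]
  have h3 : mC (P.submatrix (stepE k) (stepE k)) = mC (P'.submatrix (stepE k) (stepE k)) := by
    ext u v; rw [mC_of_mCD, mC_of_mCD, h]
  have h4 : ∀ P : Matrix ((ι → b) × γ × δ) ((ι → b) × γ × δ) ℂ,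
      mXC (P.submatrix (stepE k) (stepE k)) = (mXC P).submatrix (stepE2 k) (stepE2 k) :=
    fun P => rfl
  simp only [qcmiXD_C]
  rw [h, h1, h2, h3, h4, h4, vnEntropy_submatrix, vnEntropy_submatrix, vnEntropy_submatrix,
    vnEntropy_submatrix]
  ring

theorem restSt_congr {r : Type*} [Fintype r] [DecidableEq r] (k : ι)
    {Ts Ts' : ι → b → b → a → a → ℂ} (h : ∀ m, m ≠ k → Ts m = Ts' m)
    (ρ : Matrix ((ι → a) × r) ((ι → a) × r) ℂ) : restSt k Ts ρ = restSt k Ts' ρ := by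
  have : (fun j : {j // j ≠ k} => Ts j) = fun j : {j // j ≠ k} => Ts' j :=
    funext fun j => h j j.2
  rw [restSt, restSt, this]

theorem one_step (k : ι) {Ts Ts' : ι → b → b → a → a → ℂ} (hT : ∀ m, IsChannel (Ts m))
    (hT' : ∀ m, IsChannel (Ts' m)) (h : ∀ m, m ≠ k → Ts m = Ts' m)
    {ρ : Matrix ((ι → a) × γ × δ) ((ι → a) × γ × δ) ℂ} (hρ : ρ.PosSemidef) (hρ1 : ρ.trace = 1)
    {ε : ℝ} (hε0 : 0 ≤ ε)
    (hε : ∀ (r : Type) [Fintype r] [DecidableEq r],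
      ∀ ω : Matrix (a × r) (a × r) ℂ, ω.PosSemidef → ω.trace = 1 →
        (∀ i j, ptraceRef ω i j = ∑ K, ∑ w, ρ (glue k (i, K), w) (glue k (j, K), w)) →
        traceNorm (chApplyExt (Ts k) ω - chApplyExt (Ts' k) ω) ≤ 2 * ε) :
    |qcmiXD_C (famApply Ts ρ) - qcmiXD_C (famApply Ts' ρ)| ≤
      2 * ε * Real.log (Fintype.card b) + gFun ε := by
  set τ := restSt k Ts ρ with hτ
  have hτ' : restSt k Ts' ρ = τ := (restSt_congr k h ρ).symm
  have e1 : ∀ u v, (famApply Ts ρ).submatrix (stepE k) (stepE k) u v =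
      chApplyExt (Ts k) τ (u.1, u.2.1.1, u.2.1.2, u.2.2) (v.1, v.2.1.1, v.2.1.2, v.2.2) :=
    fun u v => famApply_split k Ts ρ _ _ _ _ _ _
  have e2 : ∀ u v, (famApply Ts' ρ).submatrix (stepE k) (stepE k) u v =
      chApplyExt (Ts' k) τ (u.1, u.2.1.1, u.2.1.2, u.2.2) (v.1, v.2.1.1, v.2.1.2, v.2.2) := by
    intro u v; rw [← hτ']
    exact famApply_split k Ts' ρ _ _ _ _ _ _
  have hm : mCD ((famApply Ts ρ).submatrix (stepE k) (stepE k)) =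
      mCD ((famApply Ts' ρ).submatrix (stepE k) (stepE k)) := by
    ext u v
    simp only [mCD, e1, e2]
    rw [chApplyExt_tp (hT k), chApplyExt_tp (hT' k)]
  rw [step_chain k _ _ hm]
  have ht : ∀ P : Matrix ((ι → b) × γ × δ) ((ι → b) × γ × δ) ℂ,
      (P.submatrix (stepE k) (stepE k)).trace = P.trace := fun P =>
    Equiv.sum_comp (stepE k) (fun z => P z z)
  have t1 : ((famApply Ts ρ).submatrix (stepE k) (stepE k)).trace = 1 := by
    rw [ht, famApply_trace hT, hρ1]
  have t2 : ((famApply Ts' ρ).submatrix (stepE k) (stepE k)).trace = 1 := by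
    rw [ht, famApply_trace hT', hρ1]
  have : Nonempty b := by
    by_contra hb
    rw [not_nonempty_iff] at hb
    simp [Matrix.trace] at t1
  refine one_copy ((famApply_posSemidef hT hρ).submatrix _)
    ((famApply_posSemidef hT' hρ).submatrix _) t1 t2 hm hε0 ?_
  let σ : Fin (Fintype.card (({j // j ≠ k} → b) × γ × δ)) ≃ (({j // j ≠ k} → b) × γ × δ) :=
    (Fintype.equivFin _).symm
  let E := Equiv.prodCongr (Equiv.refl a) σ
  let F : b × (({j // j ≠ k} → b) × γ) × δ ≃
      b × Fin (Fintype.card (({j // j ≠ k} → b) × γ × δ)) :=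
    Equiv.prodCongr (Equiv.refl b) ((Equiv.prodAssoc _ γ δ).trans σ.symm)
  have hpt : ∀ i j, ptraceRef (τ.submatrix E E) i j =
      ∑ K, ∑ w, ρ (glue k (i, K), w) (glue k (j, K), w) := by
    intro i j
    rw [← restSt_ptrace k hT]
    exact Equiv.sum_comp σ (fun w => τ (i, w) (j, w))
  have htr : (τ.submatrix E E).trace = 1 := by
    have : (τ.submatrix E E).trace = ∑ i, ptraceRef (τ.submatrix E E) i i := by
      simp only [Matrix.trace, ptraceRef, Matrix.diag_apply, Fintype.sum_prod_type]
    rw [this, ← hρ1]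
    simp only [hpt, Matrix.trace, Matrix.diag_apply]
    rw [Fintype.sum_prod_type, ← Equiv.sum_comp (glue k), Fintype.sum_prod_type]
  have hfin := hε _ (τ.submatrix E E) ((restSt_posSemidef k hT hρ).submatrix _) htr hpt
  rw [← traceNorm_submatrix _ F] at hfin
  convert hfin using 2
  ext u v
  rw [Matrix.sub_apply, e1, e2]
  simp [F, E, chApplyExt, Equiv.prodCongr]

end Step

section Final

theorem margAk_glue {n : ℕ} {a r : Type*} [Fintype a] [DecidableEq a] [Fintype r]
    (ρ : Matrix ((Fin n → a) × r) ((Fin n → a) × r) ℂ) (k : Fin n) (i j : a) :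
    margAk ρ k i j = ∑ K, ∑ w, ρ (glue k (i, K), w) (glue k (j, K), w) := by
  simp only [margAk]
  rw [← Equiv.sum_comp (glue k), Fintype.sum_prod_type_right]
  refine Finset.sum_congr rfl fun K _ => ?_
  rw [Finset.sum_comm]
  refine Finset.sum_congr rfl fun w _ => ?_
  simp only [glue_self, glue_update, Finset.sum_ite_eq', Finset.mem_univ, if_true]

end Final
theorem telescoping_qcmi_bound
    {a b γ δ : Type*} [Fintype a] [DecidableEq a] [Fintype b] [DecidableEq b]
    [Fintype γ] [DecidableEq γ] [Fintype δ] [DecidableEq δ]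
    (T S : b → b → a → a → ℂ) (hT : IsChannel T) (hS : IsChannel S)
    (n : ℕ)
    (ρ : Matrix ((Fin n → a) × γ × δ) ((Fin n → a) × γ × δ) ℂ)
    (hρ : ρ.PosSemidef) (hρ1 : ρ.trace = 1)
    (ε : ℝ) (hε0 : 0 ≤ ε)
    (hε : ∀ (r : Type) [Fintype r] [DecidableEq r],
      ∀ ω : Matrix (a × r) (a × r) ℂ, ω.PosSemidef → ω.trace = 1 →
        (∃ k : Fin n, ptraceRef ω = margAk ρ k) →
        traceNorm (chApplyExt T ω - chApplyExt S ω) ≤ 2 * ε) :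
    |qcmiXD_C (chApplyPow T ρ) - qcmiXD_C (chApplyPow S ρ)| ≤
      2 * n * ε * Real.log (Fintype.card b) + n * gFun ε := by

  let Ts : ℕ → Fin n → b → b → a → a → ℂ := fun k m => if m.val < k then T else S
  have hTs : ∀ k m, IsChannel (Ts k m) := by
    intro k m; simp only [Ts]; split_ifs <;> assumption
  have h0 : famApply (Ts 0) ρ = chApplyPow S ρ := by
    simp only [Ts, Nat.not_lt_zero, if_false]; rfl
  have hn : famApply (Ts n) ρ = chApplyPow T ρ := by
    simp only [Ts, Fin.is_lt, if_true]; rfl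
  have key : ∀ k, k ≤ n → |qcmiXD_C (famApply (Ts k) ρ) - qcmiXD_C (famApply (Ts 0) ρ)| ≤
      k * (2 * ε * Real.log (Fintype.card b) + gFun ε) := by
    intro k
    induction k with
    | zero => intro _; simp
    | succ k ih =>
      intro hk
      have h1 := ih (by omega)
      have h2 := one_step (⟨k, hk⟩ : Fin n) (hTs (k + 1)) (hTs k) (fun m hm => by
        have : m.val ≠ k := fun h => hm (Fin.ext h)
        simp only [Ts]
        by_cases h : m.val < k
        · rw [if_pos h, if_pos (by omega)]
        · rw [if_neg h, if_neg (by omega)]) hρ hρ1 hε0 (fun r _ _ ω hω hω1 hp => by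
          have e1 : Ts (k + 1) ⟨k, hk⟩ = T := by simp [Ts]
          have e2 : Ts k ⟨k, hk⟩ = S := by simp [Ts]
          rw [e1, e2]
          refine hε r ω hω hω1 ⟨⟨k, hk⟩, ?_⟩
          ext i j
          rw [hp, margAk_glue])
      have h3 := abs_sub_le (qcmiXD_C (famApply (Ts (k + 1)) ρ)) (qcmiXD_C (famApply (Ts k) ρ))
        (qcmiXD_C (famApply (Ts 0) ρ))
      push_cast
      linarith
  have := key n le_rfl
  rw [h0, hn] at this
  linarith
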